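/- arXiv:2210.05054 — 3 statements merged into one kernel-verified Lean document; each statement's English description precedes it below -/
import Mathlib

section
/- Let Y = (Y, ν, S) be an ergodic invertible ℤ-system on a standard Borel probability space. Then the set of rigid cocycles is a dense G_δ subset of Co(Y); in particular, the generic extension of Y by a cocycle into Aut(I, m) is rigid. -/
open MeasureTheory Filter Set Topology
open scoped ENNReal Classical symmDiff

section NatSlowEntropyDefs

/-- A Følner sequence for the additive semigroup `ℕ`: a sequence of nonempty finite subsets
`F n ⊆ ℕ` with `|(g + Fₙ) ∩ Fₙ| / |Fₙ| → 1` for every `g ∈ ℕ`. -/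
def IsFolnerNat (F : ℕ → Finset ℕ) : Prop :=
  (∀ n, (F n).Nonempty) ∧ ∀ g : ℕ,
    Tendsto (fun n => ((((F n).image fun h => g + h) ∩ F n).card : ℝ) / ((F n).card : ℝ))
      atTop (nhds 1)

/-- A rate function: an increasing positive function on `ℕ` tending to infinity. -/
def IsRateFunction (U : ℕ → ℝ) : Prop :=
  (∀ n, 0 < U n) ∧ Monotone U ∧ Tendsto U atTop atTop

/-- The normalized Hamming distance `d_{P,F}` (for iterates of a single map `T`). -/
noncomputable def hamDistNat {X : Type*} (T : X → X) {r : ℕ} (P : X → Fin r)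
    (F : Finset ℕ) (x x' : X) : ℝ :=
  ((F.filter fun f => P (T^[f] x) ≠ P (T^[f] x')).card : ℝ) / (F.card : ℝ)

/-- The set `E` has `d_{P,F}`-diameter at most `ε`. -/
def diamLENat {X : Type*} (T : X → X) {r : ℕ} (P : X → Fin r) (F : Finset ℕ)
    (E : Set X) (ε : ℝ) : Prop :=
  ∀ x ∈ E, ∀ x' ∈ E, hamDistNat T P F x x' ≤ ε

/-- The Hamming `ε`-covering number `cov(λ, P, F, ε)`. -/
noncomputable def hamCovNat {X : Type*} [MeasurableSpace X] (T : X → X) (lam : Measure X)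
    {r : ℕ} (P : X → Fin r) (F : Finset ℕ) (ε : ℝ) : ℕ :=
  sInf {M : ℕ | ∃ E : Fin M → Set X, (∀ i, diamLENat T P F (E i) ε) ∧
    ENNReal.ofReal (1 - ε) ≤ lam (⋃ i, E i)}

/-- The relative Hamming `ε`-covering number `cov(μ, P, F, ε | π)`, defined through the
disintegration `μy` over a factor map and the factor measure `ν`. -/
noncomputable def hamCovRelNat {X Y : Type*} [MeasurableSpace X] [MeasurableSpace Y]
    (T : X → X) (μy : Y → Measure X) (ν : Measure Y) {r : ℕ} (P : X → Fin r)
    (F : Finset ℕ) (ε : ℝ) : ℕ :=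
  sInf {M : ℕ | ∃ S : Set Y, MeasurableSet S ∧ ENNReal.ofReal (1 - ε) ≤ ν S ∧
    ∀ y ∈ S, hamCovNat T (μy y) P F ε ≤ M}

/-- Slow entropy of a partition: `sup_{ε>0} limsup_n cov(μ, P, F_n, ε)/U(|F_n|)`. -/
noncomputable def slowEntropyPartNat {X : Type*} [MeasurableSpace X] (T : X → X)
    (μ : Measure X) {r : ℕ} (P : X → Fin r) (U : ℕ → ℝ) (F : ℕ → Finset ℕ) : ℝ≥0∞ :=
  ⨆ ε ∈ Ioi (0 : ℝ),
    Filter.limsup (fun n => ENNReal.ofReal ((hamCovNat T μ P (F n) ε : ℝ) / U (F n).card))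
      atTop

/-- Slow entropy: the supremum over all finite measurable partitions. -/
noncomputable def slowEntropyNat {X : Type*} [MeasurableSpace X] (T : X → X)
    (μ : Measure X) (U : ℕ → ℝ) (F : ℕ → Finset ℕ) : ℝ≥0∞ :=
  ⨆ (r : ℕ) (P : X → Fin r) (_ : Measurable P), slowEntropyPartNat T μ P U F

/-- Relative slow entropy of a partition. -/
noncomputable def slowEntropyPartRelNat {X Y : Type*} [MeasurableSpace X] [MeasurableSpace Y]
    (T : X → X) (μy : Y → Measure X) (ν : Measure Y) {r : ℕ} (P : X → Fin r)
    (U : ℕ → ℝ) (F : ℕ → Finset ℕ) : ℝ≥0∞ :=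
  ⨆ ε ∈ Ioi (0 : ℝ),
    Filter.limsup
      (fun n => ENNReal.ofReal ((hamCovRelNat T μy ν P (F n) ε : ℝ) / U (F n).card)) atTop

/-- Relative slow entropy: the supremum over all finite measurable partitions. -/
noncomputable def slowEntropyRelNat {X Y : Type*} [MeasurableSpace X] [MeasurableSpace Y]
    (T : X → X) (μy : Y → Measure X) (ν : Measure Y)
    (U : ℕ → ℝ) (F : ℕ → Finset ℕ) : ℝ≥0∞ :=
  ⨆ (r : ℕ) (P : X → Fin r) (_ : Measurable P), slowEntropyPartRelNat T μy ν P U F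

/-- The partition distance `dist_λ(P, Q) = λ{x : P(x) ≠ Q(x)}`. -/
noncomputable def partDist {Z : Type*} [MeasurableSpace Z] (lam : Measure Z)
    {ι : Type*} (P Q : Z → ι) : ℝ≥0∞ :=
  lam {z | P z ≠ Q z}

/-- A rigid measure-preserving system: there is a sequence `0 < n₁ < n₂ < ⋯` with
`μ(T^{-n_k} A ∆ A) → 0` for every measurable `A`. -/
def IsRigidSystem {X : Type*} [MeasurableSpace X] (T : X → X) (μ : Measure X) : Prop :=
  ∃ n : ℕ → ℕ, StrictMono n ∧ 0 < n 0 ∧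
    ∀ A : Set X, MeasurableSet A →
      Tendsto (fun k => μ ((T^[n k] ⁻¹' A) ∆ A)) atTop (nhds 0)

end NatSlowEntropyDefs

section AutIDefs

/-- The group of Lebesgue-measure-preserving (bi-measurable) automorphisms of the unit
interval; we work with genuine measure-preserving measurable bijections as representatives
of their a.e.-equality classes. -/
def AutI : Type :=
  {φ : unitInterval ≃ᵐ unitInterval // MeasurePreserving φ volume volume}

/-- The skew product map `T_α(y, t) = (S y, α(y) t)` of a cocycle `α : Y → Aut(I,m)`. -/
def skewMap {Y : Type*} (S : Y → Y) (α : Y → AutI) :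
    Y × unitInterval → Y × unitInterval :=
  fun p => (S p.1, (α p.1).1 p.2)

/-- The cocycle iterates `α_n(y) = α(S^{n-1} y) ∘ ⋯ ∘ α(S y) ∘ α(y)`, so that
`T_α^n (y,t) = (S^n y, α_n(y) t)`. -/
def cocIter {Y : Type*} (S : Y → Y) (α : Y → AutI) : ℕ → Y → unitInterval → unitInterval
  | 0, _, t => t
  | n + 1, y, t => cocIter S α n (S y) ((α y).1 t)

/-- Convergence to the identity in the weak topology of `Aut(I,m)`:
`m(φₖ⁻¹ E ∆ E) → 0` for every measurable `E ⊆ I`. -/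
def TendstoIdWeak (φ : ℕ → unitInterval → unitInterval) : Prop :=
  ∀ E : Set unitInterval, MeasurableSet E →
    Tendsto (fun k => (volume : Measure unitInterval) ((φ k ⁻¹' E) ∆ E)) atTop (nhds 0)

/-- A rigid cocycle: for `ν`-a.e. `y` there is a (`y`-dependent) strictly increasing
sequence `(n_k)` with `α_{n_k}(y) → id` weakly. -/
def IsRigidCocycle {Y : Type*} [MeasurableSpace Y] (S : Y → Y) (ν : Measure Y)
    (α : Y → AutI) : Prop :=
  ∀ᵐ y ∂ν, ∃ n : ℕ → ℕ, StrictMono n ∧ TendstoIdWeak fun k => cocIter S α (n k) y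

/-- The depth-`k` dyadic partition of the unit interval, as a labeled partition. -/
noncomputable def dyadicLabel (k : ℕ) (t : unitInterval) : Fin (2 ^ k) :=
  ⟨min ⌊(t : ℝ) * 2 ^ k⌋₊ (2 ^ k - 1), by
    have h : 0 < 2 ^ k := pow_pos (by norm_num) k
    omega⟩

end AutIDefs


/-- The space of cocycles `Co(Y)` on the system `(Y, ν, S)`. -/
def Cocycle (Y : Type*) [MeasurableSpace Y] (S : Y → Y) : Type _ :=
  {α : Y → AutI // Measurable (skewMap S α)}

/-- The weak topology on `Co(Y)`, induced from the weak topology on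
`Aut(Y × I, ν × m)` via `α ↦ T_α`: it is generated by the subbasic balls
`{α : (ν × m)(T_α⁻¹ E ∆ T_β⁻¹ E) < ε}`. -/
noncomputable def cocycleTopology {Y : Type*} [MeasurableSpace Y] (S : Y → Y)
    (ν : Measure Y) : TopologicalSpace (Cocycle Y S) :=
  TopologicalSpace.generateFrom
    {U : Set (Cocycle Y S) |
      ∃ (β : Cocycle Y S) (E : Set (Y × unitInterval)) (ε : ℝ≥0∞),
        MeasurableSet E ∧ 0 < ε ∧
        U = {α : Cocycle Y S |
          (ν.prod volume) ((skewMap S α.1 ⁻¹' E) ∆ (skewMap S β.1 ⁻¹' E)) < ε}}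


/-! ### Basic facts -/

section RigidBasics

lemma exists_denseSeq : ∃ E : ℕ → Set unitInterval, (∀ i, MeasurableSet (E i)) ∧
    ∀ F, MeasurableSet F → ∀ ε : ℝ≥0∞, 0 < ε → ∃ i, volume (F ∆ E i) < ε := by
  obtain ⟨A, hAc, hA⟩ := exists_countable_measureDense (volume : Measure unitInterval)
  obtain ⟨E, rfl⟩ := hAc.exists_eq_range hA.nonempty
  refine ⟨E, fun i => hA.measurable _ ⟨i, rfl⟩, fun F hF ε hε => ?_⟩
  obtain ⟨δ, hδ0, hδ⟩ := ENNReal.lt_iff_exists_real_btwn.1 hε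
  obtain ⟨t, ⟨i, rfl⟩, hi⟩ := hA.approx F hF (measure_ne_top _ _) δ (by
    simpa using hδ.1)
  exact ⟨i, hi.trans hδ.2⟩

lemma skew_iterate {Y : Type*} (S : Y → Y) (α : Y → AutI) (n : ℕ) (p : Y × unitInterval) :
    (skewMap S α)^[n] p = (S^[n] p.1, cocIter S α n p.1 p.2) := by
  induction n generalizing p with
  | zero => rfl
  | succ n ih => rw [Function.iterate_succ_apply, ih]; rfl

lemma cocIter_mp {Y : Type*} (S : Y → Y) (α : Y → AutI) (n : ℕ) (y : Y) :
    MeasurePreserving (cocIter S α n y) volume volume := by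
  induction n generalizing y with
  | zero => exact MeasurePreserving.id _
  | succ n ih => exact (ih (S y)).comp (α y).2

variable {Y : Type*} [MeasurableSpace Y]

lemma measurable_cocIter {S : Y → Y} {α : Y → AutI} (h : Measurable (skewMap S α)) (n : ℕ) :
    Measurable fun p : Y × unitInterval => cocIter S α n p.1 p.2 := by
  have := (h.iterate n).snd
  simpa only [skew_iterate] using this

lemma skew_mp {S : Y → Y} {ν : Measure Y} [IsProbabilityMeasure ν]
    (hS : MeasurePreserving S ν ν) {α : Y → AutI} (h : Measurable (skewMap S α)) :
    MeasurePreserving (skewMap S α) (ν.prod volume) (ν.prod volume) :=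
  hS.skew_product (g := fun y t => (α y).1 t) h.snd (ae_of_all _ fun y => (α y).2.map_eq)

lemma measurable_coc_dist {S : Y → Y} {α : Y → AutI} (h : Measurable (skewMap S α)) (n : ℕ)
    {E F : Set unitInterval} (hE : MeasurableSet E) (hF : MeasurableSet F) :
    Measurable fun y => (volume : Measure unitInterval) ((cocIter S α n y ⁻¹' E) ∆ F) :=
  measurable_measure_prodMk_left
    (s := ((fun p : Y × unitInterval => cocIter S α n p.1 p.2) ⁻¹' E) ∆ (Prod.snd ⁻¹' F))
    ((measurable_cocIter h n hE).symmDiff (measurable_snd hF))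

/-- pointwise criterion for rigidity -/
lemma rigid_pt_iff {E : ℕ → Set unitInterval} (hE : ∀ i, MeasurableSet (E i))
    (hd : ∀ F, MeasurableSet F → ∀ ε : ℝ≥0∞, 0 < ε → ∃ i,
      (volume : Measure unitInterval) (F ∆ E i) < ε)
    {φ : ℕ → unitInterval → unitInterval} (hφ : ∀ n, MeasurePreserving (φ n) volume volume) :
    (∃ n : ℕ → ℕ, StrictMono n ∧ TendstoIdWeak fun k => φ (n k)) ↔
      ∀ k : ℕ, ∃ n ≥ k, (Finset.range k).sup
        (fun i => (volume : Measure unitInterval) ((φ n ⁻¹' E i) ∆ E i)) < ((k : ℝ≥0∞) + 1)⁻¹ := by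
  have hc : ∀ k : ℕ, (⊥ : ℝ≥0∞) < ((k : ℝ≥0∞) + 1)⁻¹ := fun k => by
    simp only [bot_eq_zero', ENNReal.inv_pos]; finiteness
  constructor
  · rintro ⟨n, hn, ht⟩ k
    have : ∀ᶠ j in atTop, ∀ i ∈ Finset.range k,
        (volume : Measure unitInterval) ((φ (n j) ⁻¹' E i) ∆ E i) < ((k : ℝ≥0∞) + 1)⁻¹ := by
      rw [Finset.eventually_all]
      intro i _
      exact (ht (E i) (hE i)).eventually_lt_const (hc k)
    obtain ⟨j, hj, hjk⟩ := (this.and (eventually_ge_atTop k)).exists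
    exact ⟨n j, hjk.trans (hn.id_le j), (Finset.sup_lt_iff (hc k)).2 hj⟩
  · intro h
    obtain ⟨n, hn, hP⟩ := extraction_forall_of_frequently
      (P := fun k n => ∀ i < k, (volume : Measure unitInterval) ((φ n ⁻¹' E i) ∆ E i)
        < ((k : ℝ≥0∞) + 1)⁻¹) (by
      intro k
      rw [frequently_atTop]
      intro N
      obtain ⟨n, hn, hs⟩ := h (max k N)
      refine ⟨n, (le_max_right _ _).trans hn, fun i hi => ?_⟩
      refine ((Finset.sup_lt_iff (hc _)).1 hs i
        (Finset.mem_range.2 (hi.trans_le (le_max_left _ _)))).trans_le ?_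
      gcongr
      exact le_max_left _ _)
    refine ⟨n, hn, fun F hF => ?_⟩
    have hi : ∀ i, Tendsto (fun k => (volume : Measure unitInterval)
        ((φ (n k) ⁻¹' E i) ∆ E i)) atTop (𝓝 0) := by
      intro i
      have h0 : Tendsto (fun k : ℕ => ((k : ℝ≥0∞) + 1)⁻¹) atTop (𝓝 0) := by
        have := (tendsto_add_atTop_iff_nat 1).2 ENNReal.tendsto_inv_nat_nhds_zero
        simpa using this
      refine tendsto_of_tendsto_of_tendsto_of_le_of_le' tendsto_const_nhds h0
        (Eventually.of_forall fun _ => zero_le) ?_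
      filter_upwards [eventually_gt_atTop i] with k hk using (hP k i hk).le
    rw [ENNReal.tendsto_nhds_zero]
    intro ε hε
    have hε3 : 0 < ε / 3 := ENNReal.div_pos hε.ne' (by simp)
    obtain ⟨i, hFi⟩ := hd F hF _ hε3
    filter_upwards [(hi i).eventually_lt_const hε3] with k hk
    calc (volume : Measure unitInterval) ((φ (n k) ⁻¹' F) ∆ F)
        ≤ volume ((φ (n k) ⁻¹' F) ∆ (φ (n k) ⁻¹' E i)) + volume ((φ (n k) ⁻¹' E i) ∆ F) :=
          measure_symmDiff_le _ _ _
      _ ≤ volume ((φ (n k) ⁻¹' F) ∆ (φ (n k) ⁻¹' E i)) +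
          (volume ((φ (n k) ⁻¹' E i) ∆ E i) + volume (E i ∆ F)) := by
          gcongr; exact measure_symmDiff_le _ _ _
      _ ≤ ε / 3 + (ε / 3 + ε / 3) := by
          have h1 : (volume : Measure unitInterval) ((φ (n k) ⁻¹' F) ∆ (φ (n k) ⁻¹' E i))
              = volume (F ∆ E i) := by
            rw [← (hφ (n k)).measure_preimage (hF.symmDiff (hE i)).nullMeasurableSet]; rfl
          rw [h1, symmDiff_comm (E i) F]
          gcongr
      _ = ε := by rw [← add_assoc, ENNReal.add_thirds]

lemma tendsto_iterate {S : Y → Y} {ν : Measure Y} [IsProbabilityMeasure ν]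
    (hS : MeasurePreserving S ν ν) (β : Cocycle Y S) (n : ℕ) (E : Set (Y × unitInterval))
    (hE : MeasurableSet E) :
    Tendsto (fun α : Cocycle Y S => (ν.prod volume)
      (((skewMap S α.1)^[n] ⁻¹' E) ∆ ((skewMap S β.1)^[n] ⁻¹' E)))
      (@nhds _ (cocycleTopology S ν) β) (𝓝 0) := by
  letI := cocycleTopology S ν
  have one : ∀ F : Set (Y × unitInterval), MeasurableSet F →
      Tendsto (fun α : Cocycle Y S => (ν.prod volume)
      (((skewMap S α.1) ⁻¹' F) ∆ ((skewMap S β.1) ⁻¹' F))) (𝓝 β) (𝓝 0) := by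
    intro F hF
    rw [ENNReal.tendsto_nhds_zero]
    intro ε hε
    have ho : IsOpen {α : Cocycle Y S |
          (ν.prod volume) ((skewMap S α.1 ⁻¹' F) ∆ (skewMap S β.1 ⁻¹' F)) < ε} :=
      TopologicalSpace.isOpen_generateFrom_of_mem ⟨β, F, ε, hF, hε, rfl⟩
    filter_upwards [ho.mem_nhds (by simpa using hε)] with α hα using le_of_lt hα
  induction n with
  | zero => simp
  | succ n ih =>
    have h2 := one _ (β.2.iterate n hE)
    have h3 := ih.add h2
    rw [add_zero] at h3
    refine tendsto_of_tendsto_of_tendsto_of_le_of_le tendsto_const_nhds h3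
      (fun _ => zero_le) (fun α => ?_)
    have h4 : (ν.prod volume)
        ((skewMap S α.1 ⁻¹' ((skewMap S α.1)^[n] ⁻¹' E)) ∆
          (skewMap S α.1 ⁻¹' ((skewMap S β.1)^[n] ⁻¹' E))) =
        (ν.prod volume) (((skewMap S α.1)^[n] ⁻¹' E) ∆ ((skewMap S β.1)^[n] ⁻¹' E)) := by
      rw [← (skew_mp hS α.2).measure_preimage
        ((α.2.iterate n hE).symmDiff (β.2.iterate n hE)).nullMeasurableSet]
      rfl
    simp only [Function.iterate_succ, preimage_comp]
    rw [← h4]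
    exact measure_symmDiff_le _ _ _

lemma prod_symmDiff_eq {S : Y → Y} {ν : Measure Y} [IsProbabilityMeasure ν]
    (α β : Cocycle Y S) (n : ℕ) (E : Set unitInterval) (hE : MeasurableSet E) :
    (ν.prod volume) (((skewMap S α.1)^[n] ⁻¹' (Prod.snd ⁻¹' E)) ∆
      ((skewMap S β.1)^[n] ⁻¹' (Prod.snd ⁻¹' E))) =
    ∫⁻ y, volume ((cocIter S α.1 n y ⁻¹' E) ∆ (cocIter S β.1 n y ⁻¹' E)) ∂ν := by
  rw [Measure.prod_apply ((α.2.iterate n (measurable_snd hE)).symmDiff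
    (β.2.iterate n (measurable_snd hE)))]
  congr 1
  ext y
  congr 1
  ext t
  simp [mem_symmDiff, skew_iterate]

lemma measurable_coc_dist2 {S : Y → Y} (α β : Cocycle Y S) (n : ℕ)
    {E : Set unitInterval} (hE : MeasurableSet E) :
    Measurable fun y => (volume : Measure unitInterval)
      ((cocIter S α.1 n y ⁻¹' E) ∆ (cocIter S β.1 n y ⁻¹' E)) :=
  measurable_measure_prodMk_left
    (s := ((fun p : Y × unitInterval => cocIter S α.1 n p.1 p.2) ⁻¹' E) ∆
      ((fun p : Y × unitInterval => cocIter S β.1 n p.1 p.2) ⁻¹' E))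
    ((measurable_cocIter α.2 n hE).symmDiff (measurable_cocIter β.2 n hE))

/-- The set of rigid cocycles is a `G_δ`. -/
lemma rigid_isGδ {S : Y → Y} {ν : Measure Y} [IsProbabilityMeasure ν]
    (hS : MeasurePreserving S ν ν) :
    @IsGδ _ (cocycleTopology S ν) {α : Cocycle Y S | IsRigidCocycle S ν α.1} := by
  letI := cocycleTopology S ν
  obtain ⟨E, hE, hd⟩ := exists_denseSeq
  let g : ℕ → ℕ → Cocycle Y S → Y → ℝ≥0∞ := fun k n α y => (Finset.range k).sup
        (fun i => (volume : Measure unitInterval) ((cocIter S α.1 n y ⁻¹' E i) ∆ E i))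
  have hgm : ∀ k n α, Measurable (g k n α) := by
    intro k n α
    simp only [g, Finset.sup_eq_iSup]
    exact Measurable.iSup fun i => Measurable.iSup fun _ =>
      measurable_coc_dist α.2 n (hE i) (hE i)
  let bad : ℕ → Cocycle Y S → Set Y := fun k α =>
    {y | ∀ n ≥ k, ((k : ℝ≥0∞) + 1)⁻¹ ≤ g k n α y}
  have heq : {α : Cocycle Y S | IsRigidCocycle S ν α.1} =
      ⋂ k : ℕ, ⋂ j : ℕ, {α : Cocycle Y S | ν (bad k α) < ((j : ℝ≥0∞) + 1)⁻¹} := by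
    ext α
    simp only [mem_ofPred_eq, mem_iInter, IsRigidCocycle]
    rw [Filter.eventually_congr (ae_of_all ν fun y =>
      rigid_pt_iff hE hd (φ := fun n => cocIter S α.1 n y) (fun n => cocIter_mp S α.1 n y))]
    rw [ae_all_iff]
    refine forall_congr' fun k => ?_
    have h1 : (∀ᵐ y ∂ν, ∃ n ≥ k, (Finset.range k).sup
        (fun i => (volume : Measure unitInterval) ((cocIter S α.1 n y ⁻¹' E i) ∆ E i))
          < ((k : ℝ≥0∞) + 1)⁻¹) ↔ ν (bad k α) = 0 := by
      rw [ae_iff]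
      simp only [not_exists, not_and, not_lt]
      rfl
    rw [h1]
    constructor
    · intro h j
      rw [h]
      simp only [ENNReal.inv_pos]; finiteness
    · intro h
      by_contra h0
      obtain ⟨j, hj⟩ := ENNReal.exists_inv_nat_lt h0
      have := (h j).trans (lt_of_le_of_lt (by gcongr; exact le_self_add) hj)
      exact lt_irrefl _ this
  rw [heq]
  refine IsGδ.iInter fun k => IsGδ.iInter fun j => IsOpen.isGδ ?_
  rw [isOpen_iff_mem_nhds]
  intro β hβ
  simp only [mem_ofPred_eq] at hβ
  set c : ℝ≥0∞ := ((k : ℝ≥0∞) + 1)⁻¹ with hcdef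
  -- truncated bad sets
  let bM : ℕ → Set Y := fun M =>
    {y | ∀ n ∈ Finset.Icc k M, c ≤ g k n β y + ((M : ℝ≥0∞) + 1)⁻¹}
  have hbMm : ∀ M, MeasurableSet (bM M) := by
    intro M
    have : bM M = ⋂ n ∈ Finset.Icc k M, {y | c ≤ g k n β y + ((M : ℝ≥0∞) + 1)⁻¹} := by
      ext y; simp [bM]
    rw [this]
    refine Finset.measurableSet_biInter _ fun n _ => ?_
    exact measurableSet_le measurable_const ((hgm k n β).add_const _)
  have hanti : Antitone bM := by
    intro M M' h y hy n hn
    refine (hy n ?_).trans ?_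
    · simp only [Finset.mem_Icc] at hn ⊢; omega
    · gcongr
  have hsub0 : ⋂ M, bM M ⊆ bad k β := by
    intro y hy n hn
    simp only [mem_iInter] at hy
    have h0 : Tendsto (fun M : ℕ => g k n β y + ((M : ℝ≥0∞) + 1)⁻¹) atTop (𝓝 (g k n β y + 0)) := by
      refine tendsto_const_nhds.add ?_
      have := (tendsto_add_atTop_iff_nat 1).2 ENNReal.tendsto_inv_nat_nhds_zero
      simpa using this
    rw [add_zero] at h0
    refine ge_of_tendsto h0 ?_
    filter_upwards [eventually_ge_atTop n] with M hM
    exact hy M n (Finset.mem_Icc.2 ⟨hn, hM⟩)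
  have hlim := tendsto_measure_iInter_atTop (μ := ν) (fun M => (hbMm M).nullMeasurableSet) hanti
    ⟨0, measure_ne_top _ _⟩
  obtain ⟨M, hM⟩ := (hlim.eventually_lt_const ((measure_mono hsub0).trans_lt hβ)).exists
  simp only [Function.comp_apply] at hM
  set δ : ℝ≥0∞ := ((M : ℝ≥0∞) + 1)⁻¹ with hδ
  have hδ0 : δ ≠ 0 := by simp only [hδ, ne_eq, ENNReal.inv_eq_zero]; finiteness
  have hδt : δ ≠ ∞ := by simp [hδ]
  let D : Cocycle Y S → ℕ → ℕ → ℝ≥0∞ := fun α n i =>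
    (ν.prod volume) (((skewMap S α.1)^[n] ⁻¹' (Prod.snd ⁻¹' E i)) ∆
      ((skewMap S β.1)^[n] ⁻¹' (Prod.snd ⁻¹' E i)))
  have hD : Tendsto (fun α => ν (bM M) + ∑ n ∈ Finset.Icc k M, ∑ i ∈ Finset.range k, δ⁻¹ * D α n i)
      (𝓝 β) (𝓝 (ν (bM M) + ∑ n ∈ Finset.Icc k M, ∑ i ∈ Finset.range k, δ⁻¹ * 0)) := by
    refine tendsto_const_nhds.add (tendsto_finsetSum _ fun n _ => tendsto_finsetSum _ fun i _ => ?_)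
    exact ENNReal.Tendsto.const_mul (tendsto_iterate hS β n _ (measurable_snd (hE i)))
      (Or.inr (by simpa using hδ0))
  simp only [mul_zero, Finset.sum_const_zero, add_zero] at hD
  filter_upwards [hD.eventually_lt_const hM] with α hα
  refine lt_of_le_of_lt ?_ hα
  let h : ℕ → ℕ → Y → ℝ≥0∞ := fun n i y => (volume : Measure unitInterval)
      ((cocIter S α.1 n y ⁻¹' E i) ∆ (cocIter S β.1 n y ⁻¹' E i))
  have hsub : bad k α ⊆ bM M ∪ ⋃ n ∈ Finset.Icc k M, ⋃ i ∈ Finset.range k, {y | δ ≤ h n i y} := by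
    intro y hy
    by_contra hcon
    simp only [mem_union, mem_iUnion, not_or, not_exists, mem_ofPred_eq, not_le] at hcon
    obtain ⟨h1, h2⟩ := hcon
    apply h1
    intro n hn
    refine (hy n (Finset.mem_Icc.1 hn).1).trans ?_
    refine Finset.sup_le fun i hi => ?_
    refine (measure_symmDiff_le _ (cocIter S β.1 n y ⁻¹' E i) _).trans ?_
    rw [add_comm]
    refine add_le_add ?_ (h2 n hn i hi).le
    exact Finset.le_sup (f := fun i => (volume : Measure unitInterval)
      ((cocIter S β.1 n y ⁻¹' E i) ∆ E i)) hi
  refine (measure_mono hsub).trans ((measure_union_le _ _).trans ?_)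
  gcongr
  refine (measure_biUnion_finset_le _ _).trans (Finset.sum_le_sum fun n _ => ?_)
  refine (measure_biUnion_finset_le _ _).trans (Finset.sum_le_sum fun i _ => ?_)
  have hmk := mul_meas_ge_le_lintegral (μ := ν) (measurable_coc_dist2 α β n (hE i)) δ
  rw [← prod_symmDiff_eq α β n _ (hE i)] at hmk
  rw [← ENNReal.div_eq_inv_mul]
  rw [ENNReal.le_div_iff_mul_le (Or.inl hδ0) (Or.inl hδt), mul_comm]
  exact hmk

end RigidBasics

/-! ### First return maps and periodic approximation -/

section Return

variable {X : Type*} [MeasurableSpace X]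

lemma symm_iterate_iterate (θ : X ≃ᵐ X) {m n : ℕ} (h : m ≤ n) (x : X) :
    θ.symm^[m] (θ^[n] x) = θ^[n - m] x := by
  obtain ⟨k, rfl⟩ := Nat.exists_eq_add_of_le h
  rw [Function.iterate_add_apply, Nat.add_sub_cancel_left]
  exact (Function.LeftInverse.iterate θ.left_inv m) _

lemma iterate_symm_iterate (θ : X ≃ᵐ X) {m n : ℕ} (h : m ≤ n) (x : X) :
    θ^[m] (θ.symm^[n] x) = θ.symm^[n - m] x :=
  symm_iterate_iterate θ.symm h x

/-- The predicate whose first solution is the return time (`0` outside `C`). -/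
def retP (θ : X ≃ᵐ X) (C : Set X) (n : ℕ) (x : X) : Prop :=
  (x ∉ C ∧ n = 0) ∨ (x ∈ C ∧ n ≠ 0 ∧ θ^[n] x ∈ C)

lemma retP_exists {θ : X ≃ᵐ X} {C : Set X} (h : ∀ x ∈ C, ∃ n, n ≠ 0 ∧ θ^[n] x ∈ C) (x : X) :
    ∃ n, retP θ C n x := by
  by_cases hx : x ∈ C
  · obtain ⟨n, hn⟩ := h x hx
    exact ⟨n, Or.inr ⟨hx, hn⟩⟩
  · exact ⟨0, Or.inl ⟨hx, rfl⟩⟩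

/-- Return time. -/
noncomputable def rt (θ : X ≃ᵐ X) (C : Set X) (h : ∀ x ∈ C, ∃ n, n ≠ 0 ∧ θ^[n] x ∈ C)
    (x : X) : ℕ := Nat.find (retP_exists h x)

/-- Return map. -/
noncomputable def ret (θ : X ≃ᵐ X) (C : Set X) (h : ∀ x ∈ C, ∃ n, n ≠ 0 ∧ θ^[n] x ∈ C)
    (x : X) : X := θ^[rt θ C h x] x

lemma rt_of_notMem {θ : X ≃ᵐ X} {C : Set X} (h : ∀ x ∈ C, ∃ n, n ≠ 0 ∧ θ^[n] x ∈ C)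
    {x : X} (hx : x ∉ C) : rt θ C h x = 0 := by
  rw [rt, Nat.find_eq_zero]
  exact Or.inl ⟨hx, rfl⟩

lemma ret_of_notMem {θ : X ≃ᵐ X} {C : Set X} (h : ∀ x ∈ C, ∃ n, n ≠ 0 ∧ θ^[n] x ∈ C)
    {x : X} (hx : x ∉ C) : ret θ C h x = x := by
  rw [ret, rt_of_notMem h hx]; rfl

lemma rt_spec {θ : X ≃ᵐ X} {C : Set X} (h : ∀ x ∈ C, ∃ n, n ≠ 0 ∧ θ^[n] x ∈ C)
    {x : X} (hx : x ∈ C) : rt θ C h x ≠ 0 ∧ ret θ C h x ∈ C := by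
  rcases Nat.find_spec (retP_exists h x) with h1 | h1
  · exact absurd hx h1.1
  · exact h1.2

lemma rt_min {θ : X ≃ᵐ X} {C : Set X} (h : ∀ x ∈ C, ∃ n, n ≠ 0 ∧ θ^[n] x ∈ C)
    {x : X} (hx : x ∈ C) {m : ℕ} (hm : m < rt θ C h x) (hm0 : m ≠ 0) : θ^[m] x ∉ C := by
  intro hmC
  exact Nat.find_min (retP_exists h x) hm (Or.inr ⟨hx, hm0, hmC⟩)

lemma ret_ret {θ : X ≃ᵐ X} {C : Set X} (h : ∀ x ∈ C, ∃ n, n ≠ 0 ∧ θ^[n] x ∈ C)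
    (h' : ∀ x ∈ C, ∃ n, n ≠ 0 ∧ θ.symm^[n] x ∈ C) (x : X) :
    ret θ.symm C h' (ret θ C h x) = x := by
  by_cases hx : x ∈ C
  · have h1 := rt_spec h hx
    have key : rt θ.symm C h' (ret θ C h x) = rt θ C h x := by
      rw [rt, Nat.find_eq_iff]
      refine ⟨Or.inr ⟨h1.2, h1.1, ?_⟩, ?_⟩
      · rw [ret, symm_iterate_iterate θ le_rfl, Nat.sub_self]
        exact hx
      · rintro m hm (h2 | ⟨-, h2, h3⟩)
        · exact h2.1 h1.2
        · rw [ret, symm_iterate_iterate θ hm.le] at h3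
          exact rt_min h hx (by omega) (by omega) h3
    rw [ret, key, ret, symm_iterate_iterate θ le_rfl, Nat.sub_self]
    rfl
  · rw [ret_of_notMem h hx, ret_of_notMem h' hx]

lemma measurableSet_retP {θ : X ≃ᵐ X} {C : Set X} (hC : MeasurableSet C) (n : ℕ) :
    MeasurableSet {x | retP θ C n x} := by
  have : {x | retP θ C n x} = (Cᶜ ∩ {_x | n = 0}) ∪ (C ∩ ({_x | n ≠ 0} ∩ θ^[n] ⁻¹' C)) := by
    ext x; simp [retP]
  rw [this]
  exact (hC.compl.inter (.const _)).union
    (hC.inter ((MeasurableSet.const _).inter (θ.measurable.iterate n hC)))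

lemma measurable_ret {θ : X ≃ᵐ X} {C : Set X} (hC : MeasurableSet C)
    (h : ∀ x ∈ C, ∃ n, n ≠ 0 ∧ θ^[n] x ∈ C) : Measurable (ret θ C h) :=
  Measurable.find (fun n => θ.measurable.iterate n) (fun n => measurableSet_retP hC n)
    (retP_exists h)

lemma measurable_rt {θ : X ≃ᵐ X} {C : Set X} (hC : MeasurableSet C)
    (h : ∀ x ∈ C, ∃ n, n ≠ 0 ∧ θ^[n] x ∈ C) : Measurable (rt θ C h) :=
  Measurable.find (f := fun n _ => n) (fun n => measurable_const)
    (fun n => measurableSet_retP hC n) (retP_exists h)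

/-- The return map as a measurable equivalence. -/
noncomputable def retEquiv (θ : X ≃ᵐ X) (C : Set X) (hC : MeasurableSet C)
    (h : ∀ x ∈ C, ∃ n, n ≠ 0 ∧ θ^[n] x ∈ C)
    (h' : ∀ x ∈ C, ∃ n, n ≠ 0 ∧ θ.symm^[n] x ∈ C) : X ≃ᵐ X where
  toFun := ret θ C h
  invFun := ret θ.symm C h'
  left_inv := ret_ret h h'
  right_inv := ret_ret (θ := θ.symm) h' h
  measurable_toFun := measurable_ret hC h
  measurable_invFun := measurable_ret hC h'

lemma piecewise_mp (μ : Measure X) (θ : X ≃ᵐ X) (hθ : MeasurePreserving θ μ μ) (f : X ≃ᵐ X)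
    (N : X → ℕ) (hN : Measurable N) (hf : ∀ x, f x = θ^[N x] x) : MeasurePreserving f μ μ := by
  refine ⟨f.measurable, ?_⟩
  ext E hE
  rw [f.map_apply]
  let A : ℕ → Set X := fun n => N ⁻¹' {n}
  have hA : ∀ n, MeasurableSet (A n) := fun n => hN (measurableSet_singleton n)
  have hdis : ∀ D : ℕ → Set X, (∀ n, D n ⊆ A n) → Pairwise (Function.onFun Disjoint D) := by
    intro D hD i j hij
    refine Set.disjoint_left.2 fun x hx hy => hij ?_
    exact (hD i hx : N x = i).symm.trans (hD j hy : N x = j)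
  have hm : ∀ n, MeasurableSet (A n ∩ f ⁻¹' E) := fun n => (hA n).inter (f.measurable hE)
  have e1 : f ⁻¹' E = ⋃ n, A n ∩ f ⁻¹' E := by
    ext x; simp [A]
  have e2 : E = ⋃ n, f '' (A n ∩ f ⁻¹' E) := by
    rw [← image_iUnion, ← e1, image_preimage_eq _ f.surjective]
  have hd1 := hdis (fun n => A n ∩ f ⁻¹' E) (fun n => inter_subset_left)
  have e3 : μ (f ⁻¹' E) = ∑' n, μ (A n ∩ f ⁻¹' E) := by
    conv_lhs => rw [e1]
    exact measure_iUnion hd1 hm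
  have e4 : μ E = ∑' n, μ (f '' (A n ∩ f ⁻¹' E)) := by
    conv_lhs => rw [e2]
    refine measure_iUnion ?_ fun n => f.measurableEmbedding.measurableSet_image' (hm n)
    intro i j hij
    exact (disjoint_image_iff f.injective).2 (hd1 hij)
  rw [e3, e4]
  congr 1
  ext n
  have e5 : f '' (A n ∩ f ⁻¹' E) = θ.symm^[n] ⁻¹' (A n ∩ f ⁻¹' E) := by
    have : f '' (A n ∩ f ⁻¹' E) = θ^[n] '' (A n ∩ f ⁻¹' E) := by
      refine image_congr fun x hx => ?_
      rw [hf x, (hx.1 : N x = n)]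
    rw [this]
    exact congrFun (image_eq_preimage_of_inverse (Function.LeftInverse.iterate θ.left_inv n)
      (Function.LeftInverse.iterate θ.right_inv n)) _
  rw [e5]
  exact (((hθ.symm θ).iterate n).measure_preimage (hm n).nullMeasurableSet).symm

lemma ret_periodic {φ : X ≃ᵐ X} {C : Set X} (h : ∀ x ∈ C, ∃ n, n ≠ 0 ∧ φ^[n] x ∈ C)
    (h' : ∀ x ∈ C, ∃ n, n ≠ 0 ∧ φ.symm^[n] x ∈ C) (t : X) (ht : ∃ a, φ.symm^[a] t ∈ C) :
    ∃ k, k ≠ 0 ∧ (fun x => ret φ.symm C h' (φ x))^[k] t = t := by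
  set ψ : X → X := fun x => ret φ.symm C h' (φ x) with hψ
  set a := Nat.find ht with ha
  have haC : φ.symm^[a] t ∈ C := Nat.find_spec ht
  set s := φ.symm^[a] t with hs
  have hk := rt_spec h haC
  set k := rt φ C h s with hkdef
  have hts : φ^[a] s = t := by
    rw [hs, iterate_symm_iterate φ le_rfl, Nat.sub_self]; rfl
  have hak : a < k := by
    by_contra hcon
    push Not at hcon
    have h1 : φ^[k] s = φ.symm^[a - k] t := iterate_symm_iterate φ hcon t
    have h2 : φ^[k] s ∈ C := hk.2
    rw [h1] at h2
    exact Nat.find_min ht (m := a - k) (by omega) h2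
  have hit : ∀ i < k, ψ^[i] s = φ^[i] s := by
    intro i
    induction i with
    | zero => intro _; rfl
    | succ i ih =>
      intro hi
      rw [Function.iterate_succ_apply', ih (by omega)]
      simp only [hψ]
      rw [← Function.iterate_succ_apply' φ]
      exact ret_of_notMem h' (rt_min h haC hi (by omega))
  have hper : ψ^[k] s = s := by
    obtain ⟨k', hk'⟩ := Nat.exists_eq_succ_of_ne_zero hk.1
    rw [hk', Function.iterate_succ_apply', hit k' (by omega)]
    simp only [hψ]
    rw [← Function.iterate_succ_apply' φ, ← hk']
    exact ret_ret h h' s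
  refine ⟨k, hk.1, ?_⟩
  rw [← hts, ← hit a hak, ← Function.iterate_add_apply, add_comm, Function.iterate_add_apply, hper]

/-- Points visiting `B` infinitely often in both directions. -/
def recSet (φ : X ≃ᵐ X) (B : Set X) : Set X :=
  {x | (∀ N, ∃ n ≥ N, φ^[n] x ∈ B) ∧ (∀ N, ∃ n ≥ N, φ.symm^[n] x ∈ B)}

lemma recSet_symm (φ : X ≃ᵐ X) (B : Set X) : recSet φ.symm B = recSet φ B := by
  ext x
  exact and_comm

lemma measurableSet_recSet {φ : X ≃ᵐ X} {B : Set X} (hB : MeasurableSet B) :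
    MeasurableSet (recSet φ B) := by
  have : recSet φ B = (⋂ N : ℕ, ⋃ n : ℕ, ⋃ _ : n ≥ N, φ^[n] ⁻¹' B) ∩
      (⋂ N : ℕ, ⋃ n : ℕ, ⋃ _ : n ≥ N, φ.symm^[n] ⁻¹' B) := by
    ext x; simp [recSet]
  rw [this]
  exact (MeasurableSet.iInter fun N => .iUnion fun n => .iUnion fun _ =>
    φ.measurable.iterate n hB).inter (MeasurableSet.iInter fun N => .iUnion fun n =>
      .iUnion fun _ => φ.symm.measurable.iterate n hB)

lemma recSet_map {φ : X ≃ᵐ X} {B : Set X} {x : X} (hx : x ∈ recSet φ B) : φ x ∈ recSet φ B := by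
  refine ⟨fun N => ?_, fun N => ?_⟩
  · obtain ⟨n, hn, h⟩ := hx.1 (N + 1)
    obtain ⟨m, rfl⟩ := Nat.exists_eq_add_of_le' (show 1 ≤ n by omega)
    exact ⟨m, by omega, h⟩
  · obtain ⟨n, hn, h⟩ := hx.2 N
    exact ⟨n + 1, by omega, by simpa using h⟩

lemma recSet_iterate {φ : X ≃ᵐ X} {B : Set X} {x : X} (hx : x ∈ recSet φ B) (n : ℕ) :
    φ^[n] x ∈ recSet φ B := by
  induction n with
  | zero => exact hx
  | succ n ih => rw [Function.iterate_succ_apply']; exact recSet_map ih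

lemma recSet_return {φ : X ≃ᵐ X} {B : Set X} {x : X} (hx : x ∈ recSet φ B) :
    ∃ n, n ≠ 0 ∧ φ^[n] x ∈ B ∩ recSet φ B := by
  obtain ⟨n, hn, h⟩ := hx.1 1
  exact ⟨n, by omega, h, recSet_iterate hx n⟩

lemma recSet_return_symm {φ : X ≃ᵐ X} {B : Set X} {x : X} (hx : x ∈ recSet φ B) :
    ∃ n, n ≠ 0 ∧ φ.symm^[n] x ∈ B ∩ recSet φ B := by
  rw [← recSet_symm] at hx ⊢
  exact recSet_return hx

end Return

section Marker

/-- Aperiodic points. -/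
def aper (φ : unitInterval ≃ᵐ unitInterval) : Set unitInterval :=
  {t | ∀ p : ℕ, p ≠ 0 → φ^[p] t ≠ t}

lemma aper_iterate {φ : unitInterval ≃ᵐ unitInterval} {t : unitInterval} (ht : t ∈ aper φ) (k : ℕ) :
    φ^[k] t ∈ aper φ := by
  intro p hp h
  rw [← Function.iterate_add_apply, add_comm, Function.iterate_add_apply] at h
  exact ht p hp (φ.injective.iterate k h)

lemma measurableSet_aper (φ : unitInterval ≃ᵐ unitInterval) : MeasurableSet (aper φ) := by
  have : aper φ = ⋂ p : ℕ, ⋂ _ : p ≠ 0, {t | φ^[p] t = t}ᶜ := by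
    ext t; simp [aper]
  rw [this]
  exact .iInter fun p => .iInter fun _ =>
    (measurableSet_eq_fun (φ.measurable.iterate p) measurable_id).compl

/-- Aperiodic points that are minimal among their next `n` iterates. -/
def mark (φ : unitInterval ≃ᵐ unitInterval) (n : ℕ) : Set unitInterval :=
  {t | t ∈ aper φ ∧ ∀ j ≤ n, t ≤ φ^[j] t}

lemma measurableSet_mark (φ : unitInterval ≃ᵐ unitInterval) (n : ℕ) :
    MeasurableSet (mark φ n) := by
  have : mark φ n = aper φ ∩ ⋂ j : ℕ, ⋂ _ : j ≤ n, {t | t ≤ φ^[j] t} := by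
    ext t; simp [mark]
  rw [this]
  exact (measurableSet_aper φ).inter (.iInter fun p => .iInter fun _ =>
    measurableSet_le measurable_id (φ.measurable.iterate p))

lemma mark_tendsto (φ : unitInterval ≃ᵐ unitInterval) (hφ : MeasurePreserving φ volume volume) :
    Tendsto (fun n => (volume : Measure unitInterval) (mark φ n)) atTop (𝓝 0) := by
  have hanti : Antitone (mark φ) := fun m n h t ht => ⟨ht.1, fun j hj => ht.2 j (hj.trans h)⟩
  have hlim := tendsto_measure_iInter_atTop (μ := (volume : Measure unitInterval))
    (fun n => (measurableSet_mark φ n).nullMeasurableSet) hanti ⟨0, measure_ne_top _ _⟩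
  set W := ⋂ n, mark φ n with hW
  have hWm : MeasurableSet W := .iInter fun n => measurableSet_mark φ n
  have hWs : ∀ t ∈ W, ∀ j, t ≤ φ^[j] t := fun t ht j => (mem_iInter.1 ht j).2 j le_rfl
  suffices h : (volume : Measure unitInterval) W = 0 by rw [h] at hlim; exact hlim
  have hrec : ∀ᵐ t : unitInterval, ∀ q : ℚ, t ∈ W ∩ {t | (t : ℝ) < q} →
      ∃ᶠ n in atTop, φ^[n] t ∈ W ∩ {t | (t : ℝ) < q} := by
    rw [ae_all_iff]
    intro q
    exact hφ.conservative.ae_mem_imp_frequently_image_mem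
      (hWm.inter (measurableSet_lt measurable_subtype_coe measurable_const)).nullMeasurableSet
  have : ∀ᵐ t : unitInterval, t ∉ W := by
    filter_upwards [hrec] with t ht htW
    have h2 := ht 2 ⟨htW, show (t : ℝ) < ((2 : ℚ) : ℝ) by push_cast; linarith [t.2.2]⟩
    obtain ⟨i, hi1, hi⟩ := frequently_atTop.1 h2 1
    have hlt : t < φ^[i] t :=
      lt_of_le_of_ne (hWs t htW i) ((mem_iInter.1 htW 0).1 i (by omega)).symm
    obtain ⟨q, hq1, hq2⟩ := exists_rat_btwn (show (t : ℝ) < (φ^[i] t : unitInterval) from hlt)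
    obtain ⟨n, hn, hnW⟩ := frequently_atTop.1 (ht q ⟨htW, hq1⟩) i
    have h3 := hWs _ hi.1 (n - i)
    rw [← Function.iterate_add_apply, Nat.sub_add_cancel hn] at h3
    have h4 : ((φ^[i] t : unitInterval) : ℝ) ≤ (φ^[n] t : unitInterval) := h3
    have h5 : ((φ^[n] t : unitInterval) : ℝ) < q := hnW.2
    linarith
  simpa [ae_iff] using this

lemma mark_sweep (φ : unitInterval ≃ᵐ unitInterval) (hφ : MeasurePreserving φ volume volume)
    (n : ℕ) : ∀ᵐ t : unitInterval, t ∈ aper φ → ∃ k, φ^[k] t ∈ mark φ n := by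
  let A : ℚ → Set unitInterval := fun q => {t | ∀ j ≤ n, (q : ℝ) < (φ^[j] t : unitInterval)}
  have hA : ∀ q, MeasurableSet (A q) := by
    intro q
    have : A q = ⋂ j : ℕ, ⋂ _ : j ≤ n, {t | (q : ℝ) < (φ^[j] t : unitInterval)} := by
      ext t; simp [A]
    rw [this]
    exact .iInter fun j => .iInter fun _ => measurableSet_lt measurable_const
      (measurable_subtype_coe.comp (φ.measurable.iterate j))
  have hrec : ∀ᵐ t : unitInterval, ∀ q : ℚ, t ∈ A q → ∃ᶠ n in atTop, φ^[n] t ∈ A q := by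
    rw [ae_all_iff]
    intro q
    exact hφ.conservative.ae_mem_imp_frequently_image_mem (hA q).nullMeasurableSet
  filter_upwards [hrec] with t ht hta
  by_contra hcon
  push Not at hcon
  have hdec : ∀ k, ∃ j ≤ n, φ^[k + j] t < φ^[k] t := by
    intro k
    by_contra hk
    push Not at hk
    refine hcon k ⟨aper_iterate hta k, fun j hj => ?_⟩
    rw [← Function.iterate_add_apply, add_comm]
    exact hk j hj
  obtain ⟨i, hi, hmin⟩ := Finset.exists_min_image (Finset.range (n + 1)) (fun j => φ^[j] t)
    ⟨0, by simp⟩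
  obtain ⟨j, hj, hjlt⟩ := hdec i
  obtain ⟨q, hq1, hq2⟩ := exists_rat_btwn
    (show ((φ^[i + j] t : unitInterval) : ℝ) < (φ^[i] t : unitInterval) from hjlt)
  have hwin : ∀ k ≥ i + j, ∃ l ≤ n, ((φ^[k + l] t : unitInterval) : ℝ) < q := by
    intro k hk
    induction k, hk using Nat.le_induction with
    | base => exact ⟨0, by omega, hq1⟩
    | succ k hk ih =>
      obtain ⟨l, hl, hlq⟩ := ih
      rcases Nat.eq_zero_or_pos l with rfl | hl0
      · obtain ⟨j', hj', hlt⟩ := hdec k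
        have hlt' : ((φ^[k + j'] t : unitInterval) : ℝ) < (φ^[k] t : unitInterval) := hlt
        have hj0 : j' ≠ 0 := by rintro rfl; exact lt_irrefl _ hlt
        refine ⟨j' - 1, by omega, ?_⟩
        rw [show k + 1 + (j' - 1) = k + j' by omega]
        exact hlt'.trans hlq
      · refine ⟨l - 1, by omega, ?_⟩
        rwa [show k + 1 + (l - 1) = k + l by omega]
  have htA : t ∈ A q := by
    intro l hl
    have h1 : ((φ^[i] t : unitInterval) : ℝ) ≤ (φ^[l] t : unitInterval) :=
      hmin l (Finset.mem_range.2 (by omega))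
    exact hq2.trans_le h1
  obtain ⟨k, hk, hkA⟩ := frequently_atTop.1 (ht q htA) (i + j)
  obtain ⟨l, hl, hlq⟩ := hwin k hk
  have h2 := hkA l hl
  rw [← Function.iterate_add_apply, add_comm] at h2
  exact lt_irrefl _ (h2.trans hlq)

/-- Approximation by an automorphism with finite orbits. -/
lemma exists_periodic_approx (φ : unitInterval ≃ᵐ unitInterval)
    (hφ : MeasurePreserving φ volume volume) (ε : ℝ≥0∞) (hε : 0 < ε) :
    ∃ ρ : AutI, (volume : Measure unitInterval) {t | ρ.1 t ≠ t} ≤ ε ∧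
      ∀ᵐ t : unitInterval, ∃ k, k ≠ 0 ∧ (fun x => ρ.1 (φ x))^[k] t = t := by
  obtain ⟨n, hn⟩ := ((mark_tendsto φ hφ).eventually_lt_const hε).exists
  set B := mark φ n with hB
  have hBm : MeasurableSet B := measurableSet_mark φ n
  set C := B ∩ recSet φ B with hC
  have hCm : MeasurableSet C := hBm.inter (measurableSet_recSet hBm)
  have h : ∀ x ∈ C, ∃ n, n ≠ 0 ∧ φ^[n] x ∈ C := fun x hx => recSet_return hx.2
  have h' : ∀ x ∈ C, ∃ n, n ≠ 0 ∧ φ.symm^[n] x ∈ C := fun x hx => recSet_return_symm hx.2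
  have hφs : MeasurePreserving φ.symm volume volume := hφ.symm φ
  let r : unitInterval ≃ᵐ unitInterval := retEquiv φ.symm C hCm h' h
  have hr : MeasurePreserving r volume volume :=
    piecewise_mp volume φ.symm hφs r (rt φ.symm C h') (measurable_rt hCm h') fun x => rfl
  refine ⟨⟨r, hr⟩, ?_, ?_⟩
  · refine (measure_mono ?_).trans hn.le
    intro t ht
    by_contra htB
    exact ht (ret_of_notMem h' fun htC => htB htC.1)
  · have hfw : ∀ᵐ t : unitInterval, ∀ N, φ^[N] t ∈ aper φ → ∃ k, φ^[k] (φ^[N] t) ∈ B := by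
      rw [ae_all_iff]
      intro N
      exact (hφ.iterate N).quasiMeasurePreserving.ae (mark_sweep φ hφ n)
    have hbw : ∀ᵐ t : unitInterval, ∀ N, φ^[N] t ∈ B →
        ∃ᶠ m in atTop, φ.symm^[m] (φ^[N] t) ∈ B := by
      rw [ae_all_iff]
      intro N
      exact (hφ.iterate N).quasiMeasurePreserving.ae
        (hφs.conservative.ae_mem_imp_frequently_image_mem hBm.nullMeasurableSet)
    filter_upwards [hfw, hbw] with t h1 h2
    by_cases hta : t ∈ aper φ
    · have hrec : t ∈ recSet φ B := by
        have hf : ∀ N, ∃ n ≥ N, φ^[n] t ∈ B := by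
          intro N
          obtain ⟨k, hk⟩ := h1 N (aper_iterate hta N)
          rw [← Function.iterate_add_apply] at hk
          exact ⟨k + N, by omega, hk⟩
        refine ⟨hf, fun N => ?_⟩
        obtain ⟨k, -, hk⟩ := hf 0
        obtain ⟨m, hm, hmB⟩ := frequently_atTop.1 (h2 k hk) (N + k)
        refine ⟨m - k, by omega, ?_⟩
        have e : m = (m - k) + k := by omega
        rw [e, Function.iterate_add_apply, symm_iterate_iterate φ le_rfl, Nat.sub_self] at hmB
        exact hmB
      obtain ⟨a, -, ha⟩ := recSet_return_symm hrec
      exact ret_periodic h h' t ⟨a, ha⟩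
    · have hta' := hta
      simp only [aper, mem_ofPred_eq, not_forall, not_not] at hta'
      obtain ⟨p, hp, hpt⟩ := hta'
      refine ⟨p, hp, ?_⟩
      have hall : ∀ k, φ^[k] t ∉ C := by
        intro k hk
        have h3 : φ^[p] (φ^[k] t) = φ^[k] t := by
          rw [← Function.iterate_add_apply, add_comm, Function.iterate_add_apply, hpt]
        exact hk.1.1 p hp h3
      have hit : ∀ k, (fun x => r (φ x))^[k] t = φ^[k] t := by
        intro k
        induction k with
        | zero => rfl
        | succ k ih =>
          rw [Function.iterate_succ_apply', ih]
          change r (φ (φ^[k] t)) = _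
          rw [← Function.iterate_succ_apply' φ]
          exact ret_of_notMem h' (hall _)
      exact (hit p).trans hpt

end Marker

/-! ### Density of rigid cocycles -/

section Density

/-- Composition in `AutI`. -/
def autMul (ρ β : AutI) : AutI := ⟨β.1.trans ρ.1, ρ.2.comp β.2⟩

/-- Inverse in `AutI`. -/
def autInv (ρ : AutI) : AutI := ⟨ρ.1.symm, ρ.2.symm ρ.1⟩

/-- Identity in `AutI`. -/
def autOne : AutI := ⟨MeasurableEquiv.refl _, MeasurePreserving.id _⟩

/-- The cocycle iterates as elements of `AutI`. -/
def cocAut {Y : Type*} (S : Y → Y) (α : Y → AutI) : ℕ → Y → AutI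
  | 0, _ => autOne
  | n + 1, y => autMul (cocAut S α n (S y)) (α y)

lemma cocAut_apply {Y : Type*} (S : Y → Y) (α : Y → AutI) (n : ℕ) (y : Y) (t : unitInterval) :
    (cocAut S α n y).1 t = cocIter S α n y t := by
  induction n generalizing y t with
  | zero => rfl
  | succ n ih => exact ih (S y) _

lemma cocIter_succ' {Y : Type*} (S : Y → Y) (α : Y → AutI) (n : ℕ) (y : Y) (t : unitInterval) :
    cocIter S α (n + 1) y t = (α (S^[n] y)).1 (cocIter S α n y t) := by
  have h := skew_iterate S α (n + 1) (y, t)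
  rw [Function.iterate_succ_apply', skew_iterate] at h
  exact (congrArg Prod.snd h).symm

variable {Y : Type*} [MeasurableSpace Y]

lemma rigid_of_periodic {S : Y → Y} {ν : Measure Y} {α : Y → AutI}
    (hα : ∀ᵐ y ∂ν, ∀ᵐ t : unitInterval, ∃ k, k ≠ 0 ∧ (skewMap S α)^[k] (y, t) = (y, t)) :
    IsRigidCocycle S ν α := by
  filter_upwards [hα] with y hy
  refine ⟨fun k => (k + 1).factorial, fun a b h =>
    (Nat.factorial_lt (by omega)).2 (by omega), fun E hE => ?_⟩
  let P : ℕ → Set unitInterval := fun k =>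
    {t | ∀ p ≤ k + 1, p ≠ 0 → S^[p] y = y → cocIter S α p y t ≠ t}
  have hPm : ∀ k, MeasurableSet (P k) := by
    intro k
    have : P k = ⋂ p : ℕ, ⋂ _ : p ≤ k + 1, ⋂ _ : p ≠ 0, ⋂ _ : S^[p] y = y,
        {t | cocIter S α p y t = t}ᶜ := by
      ext t; simp [P]
    rw [this]
    exact .iInter fun p => .iInter fun _ => .iInter fun _ => .iInter fun _ =>
      (measurableSet_eq_fun (cocIter_mp S α p y).measurable measurable_id).compl
  have hanti : Antitone P := fun a b h t ht p hp => ht p (by omega)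
  have hlim := tendsto_measure_iInter_atTop (μ := (volume : Measure unitInterval))
    (fun n => (hPm n).nullMeasurableSet) hanti ⟨0, measure_ne_top _ _⟩
  have h0 : (volume : Measure unitInterval) (⋂ n, P n) = 0 := by
    refine measure_mono_null ?_ hy
    intro t ht hcon
    obtain ⟨p, hp, hpt⟩ := hcon
    rw [skew_iterate] at hpt
    exact mem_iInter.1 ht p p (by omega) hp (congrArg Prod.fst hpt) (congrArg Prod.snd hpt)
  rw [h0] at hlim
  refine tendsto_of_tendsto_of_tendsto_of_le_of_le tendsto_const_nhds hlim
      (fun _ => zero_le) (fun k => measure_mono ?_)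
  intro t ht p hp hp0 h1 h2
  have hper : Function.IsPeriodicPt (skewMap S α) p (y, t) := by
    change (skewMap S α)^[p] (y, t) = (y, t)
    rw [skew_iterate]
    exact Prod.ext h1 h2
  have hper2 := hper.trans_dvd (Nat.dvd_factorial (Nat.pos_of_ne_zero hp0) hp)
  have h3 : (skewMap S α)^[(k + 1).factorial] (y, t) = (y, t) := hper2
  rw [skew_iterate] at h3
  have h4 : cocIter S α (k + 1).factorial y t = t := congrArg Prod.snd h3
  simp [mem_symmDiff, h4] at ht

lemma atomic_case [StandardBorelSpace Y] (ν : Measure Y) [IsProbabilityMeasure ν]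
    (S : Y ≃ᵐ Y) (hErg : Ergodic (⇑S) ν) (y0 : Y) (hy0 : ν {y0} ≠ 0)
    (β : Cocycle Y (⇑S)) (ε : ℝ≥0∞) (hε : 0 < ε) :
    ∃ α : Cocycle Y (⇑S), IsRigidCocycle (⇑S) ν α.1 ∧
      (ν.prod volume) {q | skewMap S α.1 q ≠ skewMap S β.1 q} ≤ ε := by
  have hS : MeasurePreserving S ν ν := hErg.toMeasurePreserving
  have hper : y0 ∈ Function.periodicPts S := by
    obtain ⟨x, hx, m, hm, hmx⟩ := hS.conservative.exists_mem_iterate_mem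
      (measurableSet_singleton y0).nullMeasurableSet hy0
    rw [mem_singleton_iff] at hx hmx
    subst hx
    exact ⟨m, Nat.pos_of_ne_zero hm, hmx⟩
  have hpos := Function.minimalPeriod_pos_of_mem_periodicPts hper
  obtain ⟨p, hp⟩ := Nat.exists_eq_add_of_le' hpos
  have hper1 : S^[p + 1] y0 = y0 := by
    have := Function.iterate_minimalPeriod (f := S) (x := y0)
    rwa [hp] at this
  set φ : AutI := cocAut S β.1 (p + 1) y0 with hφ
  obtain ⟨ρ, hρ1, hρ2⟩ := exists_periodic_approx φ.1 φ.2 ε hε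
  set y' := S^[p] y0 with hy'
  let a : Y → AutI := fun y => if y = y' then autMul ρ (β.1 y) else β.1 y
  have ha1 : ∀ y, y ≠ y' → a y = β.1 y := fun y hy => if_neg hy
  have ha2 : a y' = autMul ρ (β.1 y') := if_pos rfl
  have ham : Measurable (skewMap S a) := by
    have : skewMap S a = fun q => if q.1 = y' then
        ((skewMap S β.1 q).1, ρ.1 (skewMap S β.1 q).2) else skewMap S β.1 q := by
      funext q
      by_cases h : q.1 = y'
      · simp only [if_pos h, skewMap]
        rw [h, ha2]; rfl
      · simp only [if_neg h, skewMap]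
        rw [ha1 _ h]
    rw [this]
    refine Measurable.ite (measurable_fst (measurableSet_singleton y')) ?_ β.2
    exact β.2.fst.prodMk (ρ.1.measurable.comp β.2.snd)
  refine ⟨⟨a, ham⟩, ?_, ?_⟩
  · apply rigid_of_periodic
    change ∀ᵐ y ∂ν, ∀ᵐ t : unitInterval, ∃ k, k ≠ 0 ∧ (skewMap S a)^[k] (y, t) = (y, t)
    set T := skewMap S a with hT
    let P : Y × unitInterval → Prop := fun q => ∃ k, k ≠ 0 ∧ T^[k] q = q
    have hPm : MeasurableSet {q | P q} := by
      have : {q | P q} = ⋃ k : ℕ, ⋃ _ : k ≠ 0, {q | T^[k] q = q} := by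
        ext q; simp [P]
      rw [this]
      exact .iUnion fun k => .iUnion fun _ =>
        measurableSet_eq_fun (ham.iterate k) measurable_id
    have hTinj : Function.Injective T := by
      rintro ⟨y1, t1⟩ ⟨y2, t2⟩ h
      have h1 : y1 = y2 := S.injective (congrArg Prod.fst h)
      subst h1
      have h2 : t1 = t2 := (a y1).1.injective (congrArg Prod.snd h)
      rw [h2]
    have hPT : ∀ q, P (T q) ↔ P q := by
      intro q
      refine exists_congr fun k => and_congr_right fun _ => ?_
      rw [← Function.iterate_succ_apply, Function.iterate_succ_apply']
      exact hTinj.eq_iff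
    let Q : Set Y := {y | ∀ᵐ t : unitInterval, P (y, t)}
    have hQm : MeasurableSet Q := by
      have h1 := measurable_measure_prodMk_left (ν := (volume : Measure unitInterval)) hPm.compl
      exact h1 (measurableSet_singleton 0)
    have hQinv : S ⁻¹' Q = Q := by
      ext y
      change (∀ᵐ t : unitInterval, P (S y, t)) ↔ (∀ᵐ t : unitInterval, P (y, t))
      have h1 : ∀ t, P (S y, (a y).1 t) ↔ P (y, t) := fun t => hPT (y, t)
      constructor
      · intro h
        filter_upwards [(a y).2.quasiMeasurePreserving.ae h] with t ht using (h1 t).1 ht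
      · intro h
        filter_upwards [((a y).2.symm (a y).1).quasiMeasurePreserving.ae h] with t ht
        have := (h1 _).2 ht
        simpa using this
    have hstep : ∀ i ≤ p, ∀ t, T^[i] (y0, t) = (skewMap S β.1)^[i] (y0, t) := by
      intro i
      induction i with
      | zero => intro _ _; rfl
      | succ i ih =>
        intro hi t
        rw [Function.iterate_succ_apply', ih (by omega), Function.iterate_succ_apply',
          skew_iterate]
        have hne : S^[i] y0 ≠ y' := by
          intro h
          have := Function.iterate_injOn_Iio_minimalPeriod (f := S) (x := y0)
            (show i ∈ Iio _ by rw [mem_Iio]; omega) (show p ∈ Iio _ by rw [mem_Iio]; omega) h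
          omega
        simp only [hT, skewMap]
        rw [ha1 _ hne]
    have hTp : ∀ t, T^[p + 1] (y0, t) = (y0, ρ.1 (φ.1 t)) := by
      intro t
      rw [Function.iterate_succ_apply', hstep p le_rfl, skew_iterate]
      simp only [hT, skewMap]
      rw [← hy', ha2]
      refine Prod.ext ?_ ?_
      · change S y' = y0
        rw [hy', ← Function.iterate_succ_apply' S, hper1]
      · change ρ.1 ((β.1 y').1 _) = ρ.1 (φ.1 t)
        rw [hφ, cocAut_apply, cocIter_succ']
    have hTpk : ∀ k t, T^[(p + 1) * k] (y0, t) = (y0, (fun x => ρ.1 (φ.1 x))^[k] t) := by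
      intro k t
      rw [Function.iterate_mul]
      induction k with
      | zero => rfl
      | succ k ih =>
        rw [Function.iterate_succ_apply', ih, hTp, Function.iterate_succ_apply']
    have hy0Q : y0 ∈ Q := by
      filter_upwards [hρ2] with t ht
      obtain ⟨k, hk, hkt⟩ := ht
      refine ⟨(p + 1) * k, by positivity, ?_⟩
      rw [hTpk, hkt]
    rcases hErg.toPreErgodic.ae_mem_or_ae_notMem hQm hQinv with h | h
    · exact h
    · exfalso
      apply hy0
      refine measure_mono_null ?_ h
      intro y hy
      rw [mem_singleton_iff] at hy
      subst hy
      exact fun hc => hc hy0Q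
  · have hsub : {q | skewMap S a q ≠ skewMap S β.1 q} ⊆
        {y'} ×ˢ ((β.1 y').1 ⁻¹' {t | ρ.1 t ≠ t}) := by
      rintro ⟨y, t⟩ hq
      by_cases h : y = y'
      · subst h
        refine ⟨rfl, fun hc => hq ?_⟩
        simp only [skewMap]
        rw [ha2]
        exact Prod.ext rfl hc
      · exfalso
        apply hq
        simp only [skewMap]
        rw [ha1 _ h]
    refine (measure_mono hsub).trans ?_
    rw [Measure.prod_prod, (β.1 y').2.measure_preimage_equiv]
    calc ν {y'} * (volume : Measure unitInterval) {t | ρ.1 t ≠ t} ≤ 1 * ε := by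
          gcongr; exact prob_le_one
      _ = ε := one_mul _

lemma coboundary_measurable [StandardBorelSpace Y] (S : Y ≃ᵐ Y) (γ : Y → AutI)
    (hγ : Measurable fun q : Y × unitInterval => (γ q.1).1 q.2) :
    Measurable (skewMap S fun y => autMul (γ (S y)) (autInv (γ y))) := by
  let G : Y × unitInterval → Y × unitInterval := fun q => (q.1, (γ q.1).1 q.2)
  let H : Y × unitInterval → Y × unitInterval := fun q => (q.1, (γ q.1).1.symm q.2)
  have hGH : ∀ q, G (H q) = q := fun q => by simp [G, H]
  have hHG : ∀ q, H (G q) = q := fun q => by simp [G, H]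
  have hG : Measurable G := measurable_fst.prodMk hγ
  have hGe := hG.measurableEmbedding (Function.LeftInverse.injective hHG)
  have hH : Measurable H := by
    intro E hE
    have : H ⁻¹' E = G '' E := (congrFun (image_eq_preimage_of_inverse hHG hGH) E).symm
    rw [this]
    exact hGe.measurableSet_image' hE
  have : (skewMap S fun y => autMul (γ (S y)) (autInv (γ y))) =
      fun q => G (S (H q).1, (H q).2) := rfl
  rw [this]
  exact hG.comp ((S.measurable.comp hH.fst).prodMk hH.snd)

lemma coboundary_rigid (ν : Measure Y) [IsProbabilityMeasure ν] (S : Y ≃ᵐ Y)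
    (hS : MeasurePreserving S ν ν) (γ : Y → AutI)
    (hγ : Measurable fun q : Y × unitInterval => (γ q.1).1 q.2) :
    IsRigidCocycle S ν fun y => autMul (γ (S y)) (autInv (γ y)) := by
  obtain ⟨E, hE, hd⟩ := exists_denseSeq
  set α : Y → AutI := fun y => autMul (γ (S y)) (autInv (γ y)) with hα
  have hit : ∀ n y t, cocIter S α n y t = (γ (S^[n] y)).1 ((γ y).1.symm t) := by
    intro n
    induction n with
    | zero => intro y t; exact ((γ y).1.apply_symm_apply t).symm
    | succ n ih =>
      intro y t
      change cocIter S α n (S y) ((γ (S y)).1 ((γ y).1.symm t)) = _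
      rw [ih]
      simp
  let c : ℕ → ℝ≥0∞ := fun k => ((k : ℝ≥0∞) + 1)⁻¹
  have hc : ∀ k : ℕ, (⊥ : ℝ≥0∞) < c k := fun k => by
    simp only [c, bot_eq_zero', ENNReal.inv_pos]; finiteness
  let A : (k : ℕ) → (Fin k → ℕ) → Set Y := fun k l =>
    {y | ∀ i : Fin k, (volume : Measure unitInterval)
      (((γ y).1 ⁻¹' E i) ∆ E (l i)) < c k / 2}
  have hAm : ∀ k l, MeasurableSet (A k l) := by
    intro k l
    have : A k l = ⋂ i : Fin k, {y | (volume : Measure unitInterval)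
      (((γ y).1 ⁻¹' E i) ∆ E (l i)) < c k / 2} := by
      ext y; simp [A]
    rw [this]
    refine .iInter fun i => measurableSet_lt ?_ measurable_const
    exact measurable_measure_prodMk_left
      (s := ((fun q : Y × unitInterval => (γ q.1).1 q.2) ⁻¹' E i) ∆ (Prod.snd ⁻¹' E (l i)))
      ((hγ (hE i)).symmDiff (measurable_snd (hE (l i))))
  have hrec : ∀ᵐ y ∂ν, ∀ k, ∀ l : Fin k → ℕ, y ∈ A k l → ∃ᶠ n in atTop, S^[n] y ∈ A k l := by
    rw [ae_all_iff]
    intro k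
    rw [ae_all_iff]
    intro l
    exact hS.conservative.ae_mem_imp_frequently_image_mem (hAm k l).nullMeasurableSet
  filter_upwards [hrec] with y hy
  refine (rigid_pt_iff hE hd (φ := fun n => cocIter S α n y)
    (fun n => cocIter_mp S α n y)).2 fun k => ?_
  have hl : ∀ i : Fin k, ∃ l, (volume : Measure unitInterval)
      (((γ y).1 ⁻¹' E i) ∆ E l) < c k / 2 := fun i =>
    hd _ ((γ y).1.measurable (hE i)) _ (ENNReal.div_pos (hc k).ne' (by simp))
  choose l hl using hl
  obtain ⟨n, hn, hnA⟩ := frequently_atTop.1 (hy k l hl) k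
  refine ⟨n, hn, (Finset.sup_lt_iff (hc k)).2 fun i hi => ?_⟩
  have h1 := hnA ⟨i, Finset.mem_range.1 hi⟩
  have h2 := hl ⟨i, Finset.mem_range.1 hi⟩
  have e : (γ y).1 ⁻¹' ((cocIter S α n y ⁻¹' E i) ∆ E i) =
      ((γ (S^[n] y)).1 ⁻¹' E i) ∆ ((γ y).1 ⁻¹' E i) := by
    ext t
    simp [mem_symmDiff, hit]
  rw [← (γ y).2.measure_preimage_equiv, e]
  calc _ ≤ _ := measure_symmDiff_le _ (E (l ⟨i, Finset.mem_range.1 hi⟩)) _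
    _ < c k / 2 + c k / 2 := by
      refine ENNReal.add_lt_add h1 ?_
      rw [symmDiff_comm]
      exact h2
    _ = c k := ENNReal.add_halves _

lemma nonatomic_case [StandardBorelSpace Y] (ν : Measure Y) [IsProbabilityMeasure ν]
    (S : Y ≃ᵐ Y) (hErg : Ergodic (⇑S) ν) (B : Set Y) (hB : MeasurableSet B) (hB0 : ν B ≠ 0)
    (β : Cocycle Y (⇑S)) :
    ∃ α : Cocycle Y (⇑S), IsRigidCocycle (⇑S) ν α.1 ∧
      (ν.prod volume) {q | skewMap S α.1 q ≠ skewMap S β.1 q} ≤ ν B := by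
  have hS : MeasurePreserving S ν ν := hErg.toMeasurePreserving
  let V : Set Y := {y | ∃ m, S.symm^[m] y ∈ B}
  have hVm : MeasurableSet V := by
    have : V = ⋃ m : ℕ, S.symm^[m] ⁻¹' B := by ext y; simp [V]
    rw [this]
    exact .iUnion fun m => S.symm.measurable.iterate m hB
  have hVfull : ν Vᶜ = 0 := by
    have hsub : V ≤ᵐ[ν] S ⁻¹' V := by
      refine Eventually.of_forall fun y hy => ?_
      obtain ⟨m, hm⟩ := hy
      exact ⟨m + 1, by simpa using hm⟩
    rcases hErg.ae_empty_or_univ_of_ae_le_preimage hVm.nullMeasurableSet hsub with h | h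
    · exfalso
      apply hB0
      exact measure_mono_null (fun y hy => (⟨0, hy⟩ : y ∈ V)) (ae_eq_empty.1 h)
    · exact ae_eq_univ.1 h
  let pB : ℕ → Y → Prop := fun r y => S.symm^[r] y ∈ B ∨ (y ∉ V ∧ r = 0)
  have hpB : ∀ y, ∃ r, pB r y := by
    intro y
    by_cases h : y ∈ V
    · obtain ⟨m, hm⟩ := h
      exact ⟨m, Or.inl hm⟩
    · exact ⟨0, Or.inr ⟨h, rfl⟩⟩
  have hpBm : ∀ r, MeasurableSet {y | pB r y} := by
    intro r
    have : {y | pB r y} = (S.symm^[r] ⁻¹' B) ∪ (Vᶜ ∩ {_y | r = 0}) := by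
      ext y; simp [pB]
    rw [this]
    exact (S.symm.measurable.iterate r hB).union (hVm.compl.inter (.const _))
  let N : Y → ℕ := fun y => Nat.find (hpB y)
  let γ : Y → AutI := fun y => cocAut S β.1 (N y) (S.symm^[N y] y)
  have hγ : Measurable fun q : Y × unitInterval => (γ q.1).1 q.2 := by
    have h1 : (fun q : Y × unitInterval => (γ q.1).1 q.2) = fun q : Y × unitInterval =>
        (fun (n : ℕ) (q : Y × unitInterval) => cocIter S β.1 n (S.symm^[n] q.1) q.2)
          (Nat.find (hpB q.1)) q := by
      funext q
      exact cocAut_apply _ _ _ _ _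
    rw [h1]
    have h2 := Measurable.find
      (f := fun (n : ℕ) (q : Y × unitInterval) => cocIter S β.1 n (S.symm^[n] q.1) q.2)
      (p := fun n (q : Y × unitInterval) => pB n q.1)
      (fun n => (measurable_cocIter β.2 n).comp
        (((S.symm.measurable.iterate n).comp measurable_fst).prodMk measurable_snd))
      (fun n => measurable_fst (hpBm n)) (fun q => hpB q.1)
    convert h2
  refine ⟨⟨fun y => autMul (γ (S y)) (autInv (γ y)), coboundary_measurable S γ hγ⟩,
    coboundary_rigid ν S hS γ hγ, ?_⟩
  have hstep : ∀ y ∈ V, S y ∉ B → ∀ t, (γ (S y)).1 t = (β.1 y).1 ((γ y).1 t) := by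
    intro y hyV hyB t
    have hN : N (S y) = N y + 1 := by
      rw [Nat.find_eq_iff]
      refine ⟨Or.inl ?_, ?_⟩
      · rcases Nat.find_spec (hpB y) with h | h
        · rw [Function.iterate_succ_apply, S.symm_apply_apply]
          exact h
        · exact absurd hyV h.1
      · intro m hm hc
        have hSV : S y ∈ V := by
          obtain ⟨m, hm⟩ := hyV
          exact ⟨m + 1, by simpa using hm⟩
        rcases hc with h | h
        · cases m with
          | zero => exact hyB h
          | succ m =>
            rw [Function.iterate_succ_apply, S.symm_apply_apply] at h
            exact Nat.find_min (hpB y) (m := m) (by change m < N y; omega) (Or.inl h)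
        · exact h.1 hSV
    change (cocAut S β.1 (N (S y)) (S.symm^[N (S y)] (S y))).1 t =
      (β.1 y).1 ((cocAut S β.1 (N y) (S.symm^[N y] y)).1 t)
    rw [hN, Function.iterate_succ_apply, S.symm_apply_apply, cocAut_apply, cocAut_apply,
      cocIter_succ', iterate_symm_iterate S le_rfl, Nat.sub_self]
    rfl
  have hsub : {q | skewMap S (fun y => autMul (γ (S y)) (autInv (γ y))) q ≠ skewMap S β.1 q} ⊆
      (S ⁻¹' B ∪ Vᶜ) ×ˢ (univ : Set unitInterval) := by
    rintro ⟨y, t⟩ hq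
    refine ⟨?_, mem_univ _⟩
    by_contra hcon
    simp only [mem_union, not_or, mem_preimage, mem_compl_iff, not_not] at hcon
    apply hq
    refine Prod.ext rfl ?_
    change (γ (S y)).1 ((γ y).1.symm t) = (β.1 y).1 t
    rw [hstep y hcon.2 hcon.1, MeasurableEquiv.apply_symm_apply]
  refine (measure_mono hsub).trans ?_
  rw [Measure.prod_prod, measure_univ, mul_one]
  refine (measure_union_le _ _).trans ?_
  rw [hVfull, add_zero, hS.measure_preimage_equiv]

lemma exists_rigid_near [StandardBorelSpace Y] (ν : Measure Y) [IsProbabilityMeasure ν]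
    (S : Y ≃ᵐ Y) (hErg : Ergodic (⇑S) ν) (β : Cocycle Y (⇑S)) (ε : ℝ≥0∞) (hε : 0 < ε) :
    ∃ α : Cocycle Y (⇑S), IsRigidCocycle (⇑S) ν α.1 ∧
      (ν.prod volume) {q | skewMap S α.1 q ≠ skewMap S β.1 q} ≤ ε := by
  by_cases hat : ∃ y0, ν {y0} ≠ 0
  · obtain ⟨y0, hy0⟩ := hat
    exact atomic_case ν S hErg y0 hy0 β ε hε
  · push Not at hat
    letI := upgradeStandardBorel Y
    obtain ⟨x, -, hx⟩ := exists_mem_forall_mem_nhdsWithin_pos_measure (μ := ν) (s := univ)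
      (by simp)
    obtain ⟨U, hU, hUo, hUε⟩ := ({x} : Set Y).exists_isOpen_lt_of_lt (μ := ν) ε
      (by rw [hat x]; exact hε)
    have hU0 := hx U (by
      rw [nhdsWithin_univ]; exact hUo.mem_nhds (hU rfl))
    obtain ⟨α, h1, h2⟩ := nonatomic_case ν S hErg U hUo.measurableSet hU0.ne' β
    exact ⟨α, h1, h2.trans hUε.le⟩

lemma rigid_dense [StandardBorelSpace Y] (ν : Measure Y) [IsProbabilityMeasure ν]
    (S : Y ≃ᵐ Y) (hErg : Ergodic (⇑S) ν) :
    @Dense _ (cocycleTopology S ν) {α : Cocycle Y (⇑S) | IsRigidCocycle (⇑S) ν α.1} := by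
  letI := cocycleTopology S ν
  intro β
  have h := fun j : ℕ => exists_rigid_near ν S hErg β ((j : ℝ≥0∞) + 1)⁻¹ (by
    simp only [ENNReal.inv_pos]; finiteness)
  choose α hα1 hα2 using h
  refine mem_closure_of_tendsto (f := α) (b := atTop) ?_ (Eventually.of_forall hα1)
  refine TopologicalSpace.tendsto_nhds_generateFrom_iff.2 ?_
  rintro _ ⟨β', E, ε, hE, hε, rfl⟩ hβ
  have h0 : Tendsto (fun k : ℕ => ((k : ℝ≥0∞) + 1)⁻¹ +
      (ν.prod volume) ((skewMap S β.1 ⁻¹' E) ∆ (skewMap S β'.1 ⁻¹' E))) atTop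
      (𝓝 (0 + (ν.prod volume) ((skewMap S β.1 ⁻¹' E) ∆ (skewMap S β'.1 ⁻¹' E)))) := by
    refine Tendsto.add ?_ tendsto_const_nhds
    have := (tendsto_add_atTop_iff_nat 1).2 ENNReal.tendsto_inv_nat_nhds_zero
    simpa using this
  rw [zero_add] at h0
  filter_upwards [h0.eventually_lt_const hβ] with j hj
  refine lt_of_le_of_lt ?_ hj
  refine (measure_symmDiff_le _ (skewMap S β.1 ⁻¹' E) _).trans ?_
  gcongr
  refine (measure_mono ?_).trans (hα2 j)
  intro q hq hc
  simp [mem_symmDiff, hc] at hq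

end Density
/-- Theorem `RigidGeneric`.
For an ergodic invertible `ℤ`-system `(Y, ν, S)`, the set of rigid cocycles is a dense
`G_δ` subset of `Co(Y)`; in particular the generic extension of `Y` is rigid. -/
theorem rigid_cocycles_dense_Gdelta
    {Y : Type*} [MeasurableSpace Y] [StandardBorelSpace Y]
    (ν : Measure Y) [IsProbabilityMeasure ν]
    (S : Y ≃ᵐ Y) (hS : MeasurePreserving S ν ν) (hErg : Ergodic (⇑S) ν) :
    letI := cocycleTopology (⇑S) ν
    Dense {α : Cocycle Y (⇑S) | IsRigidCocycle (⇑S) ν α.1} ∧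
      IsGδ {α : Cocycle Y (⇑S) | IsRigidCocycle (⇑S) ν α.1} := by
  exact ⟨rigid_dense ν S hErg, rigid_isGδ hS⟩
end

section
/- Let X = (X, μ, T) be an invertible ergodic measure-preserving ℤ-system on a standard Borel probability space. The following are equivalent: (1) X is rigid, i.e. there exists a sequence 0 < n_1 < n_2 < ⋯ such that μ(T^{-n_k}A Δ A) → 0 as k → ∞ for every measurable A ⊆ X; (2) for every rate function U there exists a Følner sequence (F_n) for ℕ such that h_slow^{U,(F_n)}(X) = 0; (3) for the rate function L(n) = log n there exists a Følner sequence (F_n) for ℕ such that h_slow^{L,(F_n)}(X) = 0. -/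
open MeasureTheory Filter Set Topology
open scoped ENNReal Classical symmDiff

lemma dc_integral {X : Type*} [MeasurableSpace X] (μ : Measure X) [IsProbabilityMeasure μ]
    (F : Finset ℕ) (B : ℕ → Set X) [∀ x, DecidablePred fun f => x ∈ B f]
    (hB : ∀ f, MeasurableSet (B f)) :
    Integrable (fun x => ((F.filter fun f => x ∈ B f).card : ℝ)) μ ∧
    ∫ x, ((F.filter fun f => x ∈ B f).card : ℝ) ∂μ = ∑ f ∈ F, μ.real (B f) := by
  have h : (fun x => ((F.filter fun f => x ∈ B f).card : ℝ)) =
      fun x => ∑ f ∈ F, (B f).indicator (fun _ => (1 : ℝ)) x := by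
    funext x
    rw [Finset.card_filter]
    push_cast
    refine Finset.sum_congr rfl fun f _ => ?_
    by_cases hx : x ∈ B f <;> simp [hx]
  have hi : ∀ f ∈ F, Integrable ((B f).indicator (fun _ => (1 : ℝ))) μ := fun f _ =>
    (integrable_const (1 : ℝ)).indicator (hB f)
  rw [h]
  refine ⟨integrable_finsetSum F hi, ?_⟩
  rw [integral_finsetSum F hi]
  refine Finset.sum_congr rfl fun f _ => ?_
  rw [integral_indicator_const _ (hB f)]
  simp

lemma cov_mem {X : Type*} [MeasurableSpace X] (μ : Measure X) [IsProbabilityMeasure μ]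
    (T : X → X) (hT : Measurable T) {r : ℕ} (P : X → Fin r) (hP : Measurable P)
    (F : Finset ℕ) (hF : F.Nonempty) (N : ℕ) (ε η : ℝ) (hε : 0 < ε) (hη : 2 * η ≤ ε * ε)
    (h : ∀ f ∈ F, ∃ j < N, μ.real {x | P (T^[f] x) ≠ P (T^[j] x)} ≤ η) :
    r ^ N ∈ {M : ℕ | ∃ E : Fin M → Set X, (∀ i, diamLENat T P F (E i) ε) ∧
      ENNReal.ofReal (1 - ε) ≤ μ (⋃ i, E i)} := by
  choose! ρ hρ1 hρ2 using h
  have hPm : ∀ f, Measurable fun x => P (T^[f] x) := fun f => hP.comp (hT.iterate f)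
  set B : ℕ → Set X := fun f => {x | P (T^[f] x) ≠ P (T^[ρ f] x)} with hBdef
  have hB : ∀ f, MeasurableSet (B f) := fun f =>
    (measurableSet_eq_fun (hPm f) (hPm (ρ f))).compl
  obtain ⟨hIntB, hsum⟩ := dc_integral μ F B hB
  have hFc : (0 : ℝ) < F.card := by exact_mod_cast hF.card_pos
  set bad : Set X := {x | ε / 2 * F.card ≤ ((F.filter fun f => x ∈ B f).card : ℝ)} with hbad
  have hmk := mul_meas_ge_le_integral_of_nonneg (μ := μ)
    (f := fun x => ((F.filter fun f => x ∈ B f).card : ℝ))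
    (Eventually.of_forall fun x => by positivity) hIntB (ε / 2 * F.card)
  have hsum2 : ∑ f ∈ F, μ.real (B f) ≤ F.card * η := by
    calc ∑ f ∈ F, μ.real (B f) ≤ ∑ f ∈ F, η := Finset.sum_le_sum fun f hf => hρ2 f hf
      _ = F.card * η := by simp
  have hbadle : μ.real bad ≤ ε := by
    rw [hsum] at hmk
    have h1 : ε / 2 * F.card * μ.real bad ≤ F.card * η := hmk.trans hsum2
    have h2 : F.card * (ε * μ.real bad) ≤ F.card * (ε * ε) := by nlinarith
    have h3 := le_of_mul_le_mul_left h2 hFc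
    exact le_of_mul_le_mul_left h3 hε
  have hgood : ENNReal.ofReal (1 - ε) ≤ μ badᶜ := by
    have h1 : (1 : ℝ≥0∞) ≤ μ bad + μ badᶜ := by
      have := measure_union_le (μ := μ) bad badᶜ
      rwa [union_compl_self, measure_univ] at this
    have h2 : μ bad ≤ ENNReal.ofReal ε := by
      rw [← ofReal_measureReal]
      exact ENNReal.ofReal_le_ofReal hbadle
    rw [ENNReal.ofReal_sub _ hε.le, ENNReal.ofReal_one]
    exact tsub_le_iff_left.2 (h1.trans (by gcongr))
  refine ⟨fun i => {x | x ∈ badᶜ ∧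
    finFunctionFinEquiv (fun j : Fin N => P (T^[(j : ℕ)] x)) = i}, ?_, ?_⟩
  · rintro i x ⟨hx, hxi⟩ x' ⟨hx', hxi'⟩
    have hnm := finFunctionFinEquiv.injective (hxi.trans hxi'.symm)
    have hsub : (F.filter fun f => P (T^[f] x) ≠ P (T^[f] x')) ⊆
        (F.filter fun f => x ∈ B f) ∪ (F.filter fun f => x' ∈ B f) := by
      intro f hf
      simp only [Finset.mem_filter, Finset.mem_union] at hf ⊢
      by_contra hcon
      push Not at hcon
      have e1 : P (T^[f] x) = P (T^[ρ f] x) := by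
        have := hcon.1 hf.1; simpa [hBdef] using this
      have e2 : P (T^[f] x') = P (T^[ρ f] x') := by
        have := hcon.2 hf.1; simpa [hBdef] using this
      have e3 := congrFun hnm ⟨ρ f, hρ1 f hf.1⟩
      exact hf.2 (e1.trans (e3.trans e2.symm))
    have hc := (Finset.card_le_card hsub).trans (Finset.card_union_le _ _)
    have hc' : ((F.filter fun f => P (T^[f] x) ≠ P (T^[f] x')).card : ℝ) ≤
        ((F.filter fun f => x ∈ B f).card : ℝ) + ((F.filter fun f => x' ∈ B f).card : ℝ) := by
      exact_mod_cast hc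
    simp only [hbad, mem_compl_iff, mem_ofPred_eq, not_le] at hx hx'
    unfold hamDistNat
    rw [div_le_iff₀ hFc]
    linarith
  · refine hgood.trans (measure_mono ?_)
    intro x hx
    exact mem_iUnion.2 ⟨_, hx, rfl⟩

lemma folner_card {F : ℕ → Finset ℕ} (hF : IsFolnerNat F) :
    Tendsto (fun n => (F n).card) atTop atTop := by
  rw [tendsto_atTop]
  intro K
  have h1 := (hF.2 1).eventually (lt_mem_nhds (show 1 - 1 / ((K : ℝ) + 1) < 1 by
    have : (0 : ℝ) < 1 / ((K : ℝ) + 1) := by positivity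
    linarith))
  filter_upwards [h1] with n hn
  by_contra hlt
  push Not at hlt
  have hne := hF.1 n
  have hpos : (0 : ℝ) < (F n).card := by exact_mod_cast hne.card_pos
  have hss : ((F n).image fun h => 1 + h) ∩ F n ⊆ (F n).erase ((F n).min' hne) := by
    intro a ha
    simp only [Finset.mem_inter, Finset.mem_image] at ha
    obtain ⟨⟨b, hb, rfl⟩, ha⟩ := ha
    refine Finset.mem_erase.2 ⟨?_, ha⟩
    have := (F n).min'_le b hb
    omega
  have hc := Finset.card_le_card hss
  rw [Finset.card_erase_of_mem ((F n).min'_mem hne)] at hc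
  have hp := hne.card_pos
  have hc' : ((((F n).image fun h => 1 + h) ∩ F n).card : ℝ) + 1 ≤ (F n).card := by
    exact_mod_cast (by omega : (((F n).image fun h => 1 + h) ∩ F n).card + 1 ≤ (F n).card)
  rw [lt_div_iff₀ hpos] at hn
  have hK : ((F n).card : ℝ) ≤ K := by exact_mod_cast hlt.le
  have h2 : 1 / ((K : ℝ) + 1) * (F n).card < 1 := by
    rw [one_div, inv_mul_lt_iff₀ (by positivity)]
    linarith
  linarith

lemma strictMono_add {n : ℕ → ℕ} (hn : StrictMono n) (a b : ℕ) : n a + b ≤ n (a + b) := by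
  induction b with
  | zero => simp
  | succ b ih =>
    have := hn (show a + b < a + (b + 1) by omega)
    omega

/-- The set of sums `n (k + i (k+1)) + j` with `i < M`, `j < L`. -/
noncomputable def rigF (n : ℕ → ℕ) (k M g L : ℕ) : Finset ℕ :=
  (Finset.range M ×ˢ Finset.range L).image fun p => n (k + p.1 * (k + 1)) + p.2 + g

lemma rigF_card {n : ℕ → ℕ} (hn : StrictMono n) (k M g L : ℕ) (hL : L ≤ k + 1) :
    (rigF n k M g L).card = M * L := by
  unfold rigF
  rw [Finset.card_image_of_injOn]
  · simp
  · have key : ∀ i i' j : ℕ, i < i' → j < k + 1 →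
        n (k + i * (k + 1)) + j < n (k + i' * (k + 1)) := by
      intro i i' j hi hj
      have h1 := strictMono_add hn (k + i * (k + 1)) (k + 1)
      have h2 : k + i * (k + 1) + (k + 1) ≤ k + i' * (k + 1) := by
        have : (i + 1) * (k + 1) ≤ i' * (k + 1) := Nat.mul_le_mul_right _ hi
        linarith
      have h3 := hn.monotone h2
      omega
    rintro ⟨i, j⟩ hij ⟨i', j'⟩ hij' h
    simp only [Finset.coe_product, Finset.coe_range, mem_prod, mem_Iio] at hij hij'
    simp only at h
    rcases lt_trichotomy i i' with hlt | heq | hgt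
    · have := key i i' j hlt (by omega); omega
    · subst heq
      have : j = j' := by omega
      simp [this]
    · have := key i' i j' hgt (by omega); omega

lemma rigid_forward {X : Type*} [MeasurableSpace X] (μ : Measure X) [IsProbabilityMeasure μ]
    (T : X → X) (hT : MeasurePreserving T μ μ) (hR : IsRigidSystem T μ)
    (U : ℕ → ℝ) (hU : Monotone U) (hU' : Tendsto U atTop atTop) :
    ∃ F : ℕ → Finset ℕ, IsFolnerNat F ∧ slowEntropyNat T μ U F = 0 := by
  obtain ⟨n, hn, -, hA⟩ := hR
  have hM : ∀ k : ℕ, ∃ M : ℕ, 1 ≤ M ∧ ((k : ℝ) + 1) * ((k : ℝ) + 1) ^ (k + 1) ≤ U M := fun k =>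
    ((eventually_ge_atTop 1).and (hU'.eventually_ge_atTop _)).exists
  choose M hM1 hMU using hM
  have hcard : ∀ k, (rigF n k (M k) 0 (k + 1)).card = M k * (k + 1) := fun k =>
    rigF_card hn _ _ _ _ le_rfl
  have hne : ∀ k, (rigF n k (M k) 0 (k + 1)).Nonempty := fun k => by
    rw [← Finset.card_pos, hcard]
    exact Nat.mul_pos (hM1 k) (Nat.succ_pos k)
  refine ⟨fun k => rigF n k (M k) 0 (k + 1), ⟨hne, ?_⟩, ?_⟩
  · intro g
    have hlim : Tendsto (fun k : ℕ => 1 - (g : ℝ) * (1 / ((k : ℝ) + 1))) atTop (nhds 1) := by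
      have := (tendsto_one_div_add_atTop_nhds_zero_nat (𝕜 := ℝ)).const_mul (g : ℝ)
      simpa using this.const_sub 1
    refine tendsto_of_tendsto_of_tendsto_of_le_of_le hlim tendsto_const_nhds ?_ ?_
    · intro k
      have hpos : (0 : ℝ) < (rigF n k (M k) 0 (k + 1)).card := by
        exact_mod_cast (hne k).card_pos
      simp only
      rw [le_div_iff₀ hpos]
      have hss : rigF n k (M k) g (k + 1 - g) ⊆
          ((rigF n k (M k) 0 (k + 1)).image fun h => g + h) ∩ rigF n k (M k) 0 (k + 1) := by
        intro a ha
        simp only [rigF, Finset.mem_image, Finset.mem_product, Finset.mem_range,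
          Finset.mem_inter, Prod.exists] at ha ⊢
        obtain ⟨i, j, ⟨hi, hj⟩, rfl⟩ := ha
        exact ⟨⟨_, ⟨i, j, ⟨hi, by omega⟩, rfl⟩, by omega⟩, i, j + g, ⟨hi, by omega⟩, by omega⟩
      have hc := Finset.card_le_card hss
      rw [rigF_card hn _ _ _ _ (Nat.sub_le _ _)] at hc
      have hc' : ((M k * (k + 1 - g) : ℕ) : ℝ) ≤
        ((((rigF n k (M k) 0 (k + 1)).image fun h => g + h) ∩
          rigF n k (M k) 0 (k + 1)).card : ℝ) := by exact_mod_cast hc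
      refine le_trans ?_ hc'
      rw [hcard]
      push_cast
      have h1 : ((k : ℝ) + 1 - g) ≤ ((k + 1 - g : ℕ) : ℝ) := by
        have : k + 1 ≤ (k + 1 - g) + g := by omega
        have : ((k + 1 : ℕ) : ℝ) ≤ (((k + 1 - g) + g : ℕ) : ℝ) := by exact_mod_cast this
        push_cast at this
        linarith
      have h2 : (1 - (g : ℝ) * (1 / ((k : ℝ) + 1))) * (M k * ((k : ℝ) + 1)) =
          M k * ((k : ℝ) + 1 - g) := by
        field_simp
      rw [h2]
      gcongr
    · intro k
      have hpos : (0 : ℝ) < (rigF n k (M k) 0 (k + 1)).card := by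
        exact_mod_cast (hne k).card_pos
      simp only
      rw [div_le_one hpos]
      exact_mod_cast Finset.card_le_card Finset.inter_subset_right
  · simp only [slowEntropyNat, slowEntropyPartNat, ENNReal.iSup_eq_zero]
    intro r P hP ε hε
    have hε' : 0 < ε := hε
    apply Tendsto.limsup_eq
    -- uniform rigidity of the partition
    have hrig : Tendsto (fun k => μ.real {x | P (T^[n k] x) ≠ P x}) atTop (nhds 0) := by
      have hb : ∀ k, μ.real {x | P (T^[n k] x) ≠ P x} ≤
          ∑ a : Fin r, (μ ((T^[n k] ⁻¹' (P ⁻¹' {a})) ∆ (P ⁻¹' {a}))).toReal := by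
        intro k
        refine (measureReal_mono ?_).trans (measureReal_iUnion_fintype_le
          fun a : Fin r => (T^[n k] ⁻¹' (P ⁻¹' {a})) ∆ (P ⁻¹' {a}))
        intro x hx
        refine mem_iUnion.2 ⟨P x, Or.inr ⟨rfl, ?_⟩⟩
        simpa using hx
      have ht : Tendsto (fun k => ∑ a : Fin r,
          (μ ((T^[n k] ⁻¹' (P ⁻¹' {a})) ∆ (P ⁻¹' {a}))).toReal) atTop (nhds 0) := by
        have : ∀ a ∈ (Finset.univ : Finset (Fin r)), Tendsto (fun k =>
            (μ ((T^[n k] ⁻¹' (P ⁻¹' {a})) ∆ (P ⁻¹' {a}))).toReal) atTop (nhds 0) := by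
          intro a _
          have := hA (P ⁻¹' {a}) (hP (measurableSet_singleton a))
          exact (ENNReal.tendsto_toReal ENNReal.zero_ne_top).comp this
        simpa using tendsto_finsetSum _ this
      exact squeeze_zero (fun k => measureReal_nonneg) hb ht
    obtain ⟨K, hK⟩ := eventually_atTop.1
      (hrig.eventually (gt_mem_nhds (show 0 < ε * ε / 2 by positivity)))
    have hbd : ∀ᶠ k in atTop, ENNReal.ofReal
        ((hamCovNat T μ P (rigF n k (M k) 0 (k + 1)) ε : ℝ) /
          U (rigF n k (M k) 0 (k + 1)).card) ≤ ENNReal.ofReal (1 / ((k : ℝ) + 1)) := by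
      filter_upwards [eventually_ge_atTop K, eventually_ge_atTop r] with k hkK hkr
      apply ENNReal.ofReal_le_ofReal
      have hmem := cov_mem μ T hT.measurable P hP (rigF n k (M k) 0 (k + 1)) (hne k) (k + 1) ε
        (ε * ε / 2) hε' (by linarith) (by
          intro f hf
          simp only [rigF, Finset.mem_image, Finset.mem_product, Finset.mem_range,
            Prod.exists] at hf
          obtain ⟨i, j, ⟨hi, hj⟩, rfl⟩ := hf
          refine ⟨j, hj, ?_⟩
          have h1 := hK (k + i * (k + 1)) (by nlinarith)
          refine le_trans (le_of_eq ?_) h1.le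
          have hms : MeasurableSet {x | P (T^[n (k + i * (k + 1))] x) ≠ P x} :=
            (measurableSet_eq_fun (hP.comp (hT.measurable.iterate _)) hP).compl
          rw [← (hT.iterate j).measureReal_preimage hms.nullMeasurableSet]
          congr 1
          ext x
          simp only [mem_ofPred_eq, mem_preimage, add_zero, Function.iterate_add_apply])
      have hcov : hamCovNat T μ P (rigF n k (M k) 0 (k + 1)) ε ≤ r ^ (k + 1) := Nat.sInf_le hmem
      have hcov' : (hamCovNat T μ P (rigF n k (M k) 0 (k + 1)) ε : ℝ) ≤
          ((k : ℝ) + 1) ^ (k + 1) := by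
        calc (hamCovNat T μ P (rigF n k (M k) 0 (k + 1)) ε : ℝ) ≤ (r : ℝ) ^ (k + 1) := by
              exact_mod_cast hcov
          _ ≤ ((k : ℝ) + 1) ^ (k + 1) := by
            gcongr
            have : (r : ℝ) ≤ k := by exact_mod_cast hkr
            linarith
      have hUk : ((k : ℝ) + 1) * ((k : ℝ) + 1) ^ (k + 1) ≤
          U (rigF n k (M k) 0 (k + 1)).card := by
        refine (hMU k).trans (hU ?_)
        rw [hcard]
        exact Nat.le_mul_of_pos_right _ (Nat.succ_pos k)
      have hk0 : (0 : ℝ) < (k : ℝ) + 1 := by positivity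
      have hUpos : 0 < U (rigF n k (M k) 0 (k + 1)).card :=
        lt_of_lt_of_le (by positivity) hUk
      rw [div_le_div_iff₀ hUpos hk0]
      nlinarith
    have hz : Tendsto (fun k : ℕ => ENNReal.ofReal (1 / ((k : ℝ) + 1))) atTop (nhds 0) := by
      have := ENNReal.tendsto_ofReal (tendsto_one_div_add_atTop_nhds_zero_nat (𝕜 := ℝ))
      simpa using this
    exact tendsto_of_tendsto_of_tendsto_of_le_of_le' tendsto_const_nhds hz
      (Eventually.of_forall fun _ => zero_le) hbd

/-- Pigeonhole step: a cheap Hamming cover yields a large return time. -/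
lemma pigeon_step {X : Type*} [MeasurableSpace X] (μ : Measure X) [IsProbabilityMeasure μ]
    (T : X → X) (hT : MeasurePreserving T μ μ) {r : ℕ} (P : X → Fin r) (hP : Measurable P)
    (F : Finset ℕ) (hF : F.Nonempty) (δ : ℝ) (hδ : 0 < δ) (hδ1 : δ < 1) (M K : ℕ) (hK : 0 < K)
    (E : Fin M → Set X) (hE : ∀ i, diamLENat T P F (E i) (δ / 2))
    (hcov : ENNReal.ofReal (1 - δ / 2) ≤ μ (⋃ i, E i))
    (hcard : 2 * (r ^ M * K) < F.card) :
    ∃ t ≥ K, μ.real {x | P (T^[t] x) ≠ P x} ≤ 3 * δ := by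
  have hPm : ∀ f, Measurable fun x => P (T^[f] x) := fun f => hP.comp (hT.measurable.iterate f)
  have hFc : (0 : ℝ) < F.card := by exact_mod_cast hF.card_pos
  have hMne : Nonempty (Fin M) := by
    by_contra hemp
    rw [not_nonempty_iff] at hemp
    rw [iUnion_of_empty, measure_empty, nonpos_iff_eq_zero, ENNReal.ofReal_eq_zero] at hcov
    linarith
  have hXne : Nonempty X := μ.nonempty_of_neZero
  have hc : ∀ i, ∃ c : X, (E i).Nonempty → c ∈ E i := fun i => by
    by_cases h : (E i).Nonempty
    · exact ⟨h.some, fun _ => h.some_mem⟩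
    · exact ⟨hXne.some, fun h' => absurd h' h⟩
  choose c hc using hc
  set N : X → (F → Fin r) := fun x f => P (T^[(f : ℕ)] x) with hN
  have hNm : Measurable N := measurable_pi_lambda _ fun f => hPm f
  have hσ : ∀ w : F → Fin r, ∃ i : Fin M, (∃ i, ∃ x ∈ E i, N x = w) → ∃ x ∈ E i, N x = w := by
    intro w
    by_cases h : ∃ i, ∃ x ∈ E i, N x = w
    · exact ⟨h.choose, fun _ => h.choose_spec⟩
    · exact ⟨hMne.some, fun h' => absurd h' h⟩
  choose σ hσ using hσ
  -- the good set
  set G : Set X := {x | hamDistNat T P F x (c (σ (N x))) ≤ δ / 2} with hG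
  have hGm : MeasurableSet G := by
    have : G = N ⁻¹' {w | ((F.attach.filter fun f => w f ≠ P (T^[(f : ℕ)] (c (σ w)))).card : ℝ)
        / F.card ≤ δ / 2} := by
      ext x
      simp only [hG, mem_ofPred_eq, mem_preimage, hamDistNat]
      have : (F.filter fun f => P (T^[f] x) ≠ P (T^[f] (c (σ (N x))))).card =
          (F.attach.filter fun f => N x f ≠ P (T^[(f : ℕ)] (c (σ (N x))))).card := by
        rw [Finset.card_filter, Finset.card_filter, ← Finset.sum_attach]
      rw [this]
    rw [this]
    exact hNm (MeasurableSet.of_discrete)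
  have hEG : (⋃ i, E i) ⊆ G := by
    intro x hx
    obtain ⟨i, hi⟩ := mem_iUnion.1 hx
    obtain ⟨x', hx', hNx⟩ := hσ (N x) ⟨i, x, hi, rfl⟩
    have h1 := hE _ x' hx' (c (σ (N x))) (hc _ ⟨x', hx'⟩)
    have h2 : hamDistNat T P F x (c (σ (N x))) = hamDistNat T P F x' (c (σ (N x))) := by
      unfold hamDistNat
      congr 3
      apply Finset.filter_congr
      intro f hf
      have := congrFun hNx ⟨f, hf⟩
      simp only [hN] at this
      rw [this]
    simp only [hG, mem_ofPred_eq, h2]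
    exact h1
  have hGc : μ.real Gᶜ ≤ δ / 2 := by
    rw [probReal_compl_eq_one_sub hGm]
    have h1 := hcov.trans (measure_mono hEG)
    have h2 : 1 - δ / 2 ≤ μ.real G :=
      (ENNReal.ofReal_le_iff_le_toReal (measure_ne_top μ G)).1 h1
    linarith
  set B : ℕ → Set X := fun f => G ∩ {x | P (T^[f] x) ≠ P (T^[f] (c (σ (N x))))} with hB
  have hBm : ∀ f, MeasurableSet (B f) := fun f => by
    refine hGm.inter (measurableSet_eq_fun (hPm f) ?_).compl
    exact (Measurable.of_discrete (f := fun w => P (T^[f] (c (σ w))))).comp hNm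
  obtain ⟨hIntB, hsum⟩ := dc_integral μ F B hBm
  have hsum2 : ∑ f ∈ F, μ.real (B f) ≤ δ / 2 * F.card := by
    rw [← hsum]
    calc ∫ x, ((F.filter fun f => x ∈ B f).card : ℝ) ∂μ ≤ ∫ x, δ / 2 * F.card ∂μ := by
          refine integral_mono hIntB (integrable_const _) fun x => ?_
          simp only
          by_cases hx : x ∈ G
          · have h1 := hx
            simp only [hG, mem_ofPred_eq, hamDistNat] at h1
            rw [div_le_iff₀ hFc] at h1
            refine le_trans ?_ h1
            have : (F.filter fun f => x ∈ B f) ⊆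
                F.filter fun f => P (T^[f] x) ≠ P (T^[f] (c (σ (N x)))) := by
              intro f hf
              rw [Finset.mem_filter] at hf ⊢
              exact ⟨hf.1, hf.2.2⟩
            exact_mod_cast Finset.card_le_card this
          · have : (F.filter fun f => x ∈ B f) = ∅ := by
              apply Finset.filter_eq_empty_iff.2
              intro f _ hf
              exact hx hf.1
            rw [this]
            simp only [Finset.card_empty, Nat.cast_zero]
            positivity
      _ = δ / 2 * F.card := by simp
  set A : Finset ℕ := F.filter fun f => μ.real (B f) ≤ δ with hAdef
  have hAcard : F.card ≤ 2 * A.card := by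
    have h1 : ((F.filter fun f => ¬ μ.real (B f) ≤ δ).card : ℝ) * δ ≤ δ / 2 * F.card := by
      calc ((F.filter fun f => ¬ μ.real (B f) ≤ δ).card : ℝ) * δ
          = ∑ f ∈ F.filter (fun f => ¬ μ.real (B f) ≤ δ), δ := by simp
        _ ≤ ∑ f ∈ F.filter (fun f => ¬ μ.real (B f) ≤ δ), μ.real (B f) := by
          refine Finset.sum_le_sum fun f hf => ?_
          exact (not_le.1 (Finset.mem_filter.1 hf).2).le
        _ ≤ ∑ f ∈ F, μ.real (B f) :=
          Finset.sum_le_sum_of_subset_of_nonneg (Finset.filter_subset _ _)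
            fun _ _ _ => measureReal_nonneg
        _ ≤ _ := hsum2
    have h2 : 2 * ((F.filter fun f => ¬ μ.real (B f) ≤ δ).card : ℝ) ≤ F.card := by
      have : δ * (2 * ((F.filter fun f => ¬ μ.real (B f) ≤ δ).card : ℝ)) ≤ δ * F.card := by
        linarith
      exact le_of_mul_le_mul_left this hδ
    have h2' : 2 * (F.filter fun f => ¬ μ.real (B f) ≤ δ).card ≤ F.card := by exact_mod_cast h2
    have h3 : A.card + (F.filter fun f => ¬ μ.real (B f) ≤ δ).card = F.card := by
      rw [hAdef]
      convert Finset.card_filter_add_card_filter_not (s := F) (fun f => μ.real (B f) ≤ δ)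
    omega
  -- pigeonhole
  let col : ℕ → (Fin M → Fin r) × ZMod K := fun f => (fun i => P (T^[f] (c i)), (f : ZMod K))
  have : NeZero K := ⟨hK.ne'⟩
  have hcc : (Finset.univ : Finset ((Fin M → Fin r) × ZMod K)).card < A.card := by
    rw [Finset.card_univ, Fintype.card_prod, Fintype.card_fun, Fintype.card_fin,
      Fintype.card_fin, ZMod.card]
    omega
  obtain ⟨f, hf, f', hf', hne, heq⟩ := Finset.exists_ne_map_eq_of_card_lt_of_maps_to hcc
    (f := col) (fun _ _ => Finset.mem_coe.2 (Finset.mem_univ _))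
  have main : ∀ f ∈ A, ∀ f' ∈ A, f < f' → col f = col f' →
      ∃ t ≥ K, μ.real {x | P (T^[t] x) ≠ P x} ≤ 3 * δ := by
    intro f hf f' hf' hlt heq
    have h1 : ∀ i, P (T^[f] (c i)) = P (T^[f'] (c i)) := fun i =>
      congrFun (congrArg Prod.fst heq) i
    have h2 : (f : ZMod K) = (f' : ZMod K) := congrArg Prod.snd heq
    have h3 : K ∣ f' - f :=
      (Nat.modEq_iff_dvd' hlt.le).1 ((ZMod.natCast_eq_natCast_iff _ _ _).1 h2)
    refine ⟨f' - f, Nat.le_of_dvd (by omega) h3, ?_⟩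
    have hms : MeasurableSet {x | P (T^[f' - f] x) ≠ P x} :=
      (measurableSet_eq_fun (hPm _) hP).compl
    rw [← (hT.iterate f).measureReal_preimage hms.nullMeasurableSet]
    have hsub : T^[f] ⁻¹' {x | P (T^[f' - f] x) ≠ P x} ⊆ (Gᶜ ∪ B f) ∪ B f' := by
      intro x hx
      simp only [mem_preimage, mem_ofPred_eq, ← Function.iterate_add_apply] at hx
      rw [Nat.sub_add_cancel hlt.le] at hx
      by_contra hcon
      simp only [mem_union, mem_compl_iff, not_or, not_not] at hcon
      obtain ⟨⟨hxG, hb⟩, hb'⟩ := hcon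
      have e1 : P (T^[f] x) = P (T^[f] (c (σ (N x)))) := by
        by_contra h; exact hb ⟨hxG, h⟩
      have e2 : P (T^[f'] x) = P (T^[f'] (c (σ (N x)))) := by
        by_contra h; exact hb' ⟨hxG, h⟩
      exact hx (e2.trans ((h1 _).symm.trans e1.symm))
    have hm := (measureReal_mono (μ := μ) hsub).trans ((measureReal_union_le _ _).trans
      (add_le_add_left (measureReal_union_le _ _) _))
    have hb := (Finset.mem_filter.1 hf).2
    have hb' := (Finset.mem_filter.1 hf').2
    linarith
  rcases lt_or_gt_of_ne hne with h | h
  · exact main f hf f' hf' h heq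
  · exact main f' hf' f hf h heq.symm

lemma return_times {X : Type*} [MeasurableSpace X] (μ : Measure X) [IsProbabilityMeasure μ]
    (T : X → X) (hT : MeasurePreserving T μ μ) (U : ℕ → ℝ)
    (hUpos : ∀ᶠ n in atTop, 0 < U n) (hUlog : ∀ n : ℕ, U n ≤ Real.log ((n : ℝ) + 3))
    (F : ℕ → Finset ℕ) (hF : IsFolnerNat F) (h0 : slowEntropyNat T μ U F = 0)
    {r : ℕ} (P : X → Fin r) (hP : Measurable P) (δ : ℝ) (hδ : 0 < δ) (hδ1 : δ < 1)
    (K : ℕ) (hK : 0 < K) : ∃ t ≥ K, μ.real {x | P (T^[t] x) ≠ P x} ≤ 3 * δ := by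
  simp only [slowEntropyNat, slowEntropyPartNat, ENNReal.iSup_eq_zero] at h0
  have hl := h0 r P hP (δ / 2) (show 0 < δ / 2 by positivity)
  have hlogr : 0 < Real.log ((r : ℝ) + 2) := Real.log_pos (by linarith [Nat.cast_nonneg (α := ℝ) r])
  set a : ℝ := 1 / (2 * Real.log ((r : ℝ) + 2)) with ha
  have hapos : 0 < a := by positivity
  have hev := eventually_lt_of_limsup_lt (b := ENNReal.ofReal a)
    (lt_of_le_of_lt hl.le (ENNReal.ofReal_pos.2 hapos))
  have hcd := folner_card hF
  obtain ⟨m, hm1, hm2, hm3⟩ := (hev.and ((hcd.eventually hUpos).and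
    (hcd.eventually_ge_atTop (16 * K * K + 3)))).exists
  have hmem : hamCovNat T μ P (F m) (δ / 2) ∈ {M : ℕ | ∃ E : Fin M → Set X,
      (∀ i, diamLENat T P (F m) (E i) (δ / 2)) ∧
      ENNReal.ofReal (1 - δ / 2) ≤ μ (⋃ i, E i)} :=
    Nat.sInf_mem ⟨_, cov_mem μ T hT.measurable P hP (F m) (hF.1 m) ((F m).sup id + 1) (δ / 2) 0
      (by positivity) (by nlinarith) (fun f hf => ⟨f,
        Nat.lt_succ_of_le (Finset.le_sup (f := id) hf), by simp⟩)⟩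
  set M := hamCovNat T μ P (F m) (δ / 2)
  obtain ⟨E, hE, hcov⟩ := hmem
  refine pigeon_step μ T hT P hP (F m) (hF.1 m) δ hδ hδ1 M K hK E hE hcov ?_
  have h1 : (M : ℝ) < a * U (F m).card := by
    have := (ENNReal.ofReal_lt_ofReal_iff hapos).1 hm1
    rwa [div_lt_iff₀ hm2] at this
  have h2 : (M : ℝ) * (2 * Real.log ((r : ℝ) + 2)) ≤ Real.log (((F m).card : ℝ) + 3) := by
    have : a * (2 * Real.log ((r : ℝ) + 2)) = 1 := by rw [ha]; field_simp
    calc (M : ℝ) * (2 * Real.log ((r : ℝ) + 2)) ≤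
          a * U (F m).card * (2 * Real.log ((r : ℝ) + 2)) := by gcongr
      _ = U (F m).card * (a * (2 * Real.log ((r : ℝ) + 2))) := by ring
      _ = U (F m).card := by rw [this, mul_one]
      _ ≤ _ := hUlog _
  have h3 : (((r : ℝ) + 2) ^ M) ^ 2 ≤ ((F m).card : ℝ) + 3 := by
    rw [← Real.log_le_log_iff (by positivity) (by positivity), Real.log_pow, Real.log_pow]
    push_cast
    linarith
  have h4 : ((r : ℝ) ^ M) ^ 2 ≤ ((F m).card : ℝ) + 3 := by
    refine le_trans ?_ h3
    gcongr
    linarith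
  have h5 : (r ^ M) ^ 2 ≤ (F m).card + 3 := by exact_mod_cast h4
  by_contra hcon
  push Not at hcon
  have h6 : (F m).card * (F m).card ≤ (2 * (r ^ M * K)) * (2 * (r ^ M * K)) :=
    Nat.mul_le_mul hcon hcon
  have h7 : (2 * (r ^ M * K)) * (2 * (r ^ M * K)) = 4 * K * K * (r ^ M) ^ 2 := by ring
  have h8 : 4 * K * K * (r ^ M) ^ 2 ≤ 4 * K * K * ((F m).card + 3) := Nat.mul_le_mul_left _ h5
  have h9 : 1 ≤ K * K := Nat.mul_pos hK hK
  nlinarith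

lemma rigid_backward {X : Type*} [MeasurableSpace X] [StandardBorelSpace X] (μ : Measure X)
    [IsProbabilityMeasure μ]
    (T : X → X) (hT : MeasurePreserving T μ μ) (U : ℕ → ℝ)
    (hUpos : ∀ᶠ n in atTop, 0 < U n) (hUlog : ∀ n : ℕ, U n ≤ Real.log ((n : ℝ) + 3))
    (F : ℕ → Finset ℕ) (hF : IsFolnerNat F) (h0 : slowEntropyNat T μ U F = 0) :
    IsRigidSystem T μ := by
  obtain ⟨𝒜, h𝒜c, h𝒜⟩ := MeasureTheory.exists_countable_measureDense μ
  obtain ⟨A, hA⟩ := h𝒜c.exists_eq_range h𝒜.nonempty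
  have hAm : ∀ i, MeasurableSet (A i) := fun i => h𝒜.measurable _ (hA ▸ mem_range_self i)
  let Q : (k : ℕ) → X → (Fin k → Fin 2) := fun k x i => if x ∈ A i then 1 else 0
  have hQ : ∀ k, Measurable (Q k) := fun k => measurable_pi_lambda _ fun i =>
    Measurable.ite (hAm i) measurable_const measurable_const
  let P : (k : ℕ) → X → Fin (2 ^ k) := fun k x => finFunctionFinEquiv (Q k x)
  have hP : ∀ k, Measurable (P k) := fun k => Measurable.of_discrete.comp (hQ k)
  have hfr : ∀ k : ℕ, ∃ᶠ t in atTop, 0 < t ∧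
      μ.real {x | P k (T^[t] x) ≠ P k x} ≤ 3 * (1 / ((k : ℝ) + 2)) := by
    intro k
    rw [frequently_atTop]
    intro K
    obtain ⟨t, ht, h⟩ := return_times μ T hT U hUpos hUlog F hF h0 (P k) (hP k)
      (1 / ((k : ℝ) + 2)) (by positivity)
      (by rw [div_lt_one (by positivity)]; linarith [Nat.cast_nonneg (α := ℝ) k]) (K + 1) (by omega)
    exact ⟨t, by omega, by omega, h⟩
  obtain ⟨n, hn, hnP⟩ := extraction_forall_of_frequently hfr
  refine ⟨n, hn, (hnP 0).1, fun S hS => ?_⟩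
  have hlim : Tendsto (fun k : ℕ => 3 * (1 / ((k : ℝ) + 2))) atTop (nhds 0) := by
    have h1 := (tendsto_add_atTop_iff_nat 1).2 (tendsto_one_div_add_atTop_nhds_zero_nat (𝕜 := ℝ))
    have h2 := h1.const_mul 3
    rw [mul_zero] at h2
    refine h2.congr fun k => ?_
    push_cast
    ring
  rw [ENNReal.tendsto_nhds_zero]
  intro ε hε
  obtain ⟨η, hη, hηε⟩ : ∃ η : ℝ, 0 < η ∧ ENNReal.ofReal (3 * η) ≤ ε := by
    rcases eq_or_ne ε ⊤ with h | h
    · exact ⟨1, one_pos, by simp [h]⟩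
    · refine ⟨ε.toReal / 3, div_pos (ENNReal.toReal_pos hε.ne' h) (by norm_num), ?_⟩
      rw [mul_div_cancel₀ _ (by norm_num), ENNReal.ofReal_toReal h]
  obtain ⟨V, hV, hSV⟩ := h𝒜.approx S hS (measure_ne_top μ S) η hη
  rw [hA] at hV
  obtain ⟨i, rfl⟩ := hV
  filter_upwards [hlim.eventually (gt_mem_nhds hη), eventually_gt_atTop i] with k hk hik
  have hSV' : μ.real (S ∆ A i) ≤ η :=
    ENNReal.toReal_le_of_le_ofReal hη.le hSV.le
  have h1 : μ.real (T^[n k] ⁻¹' (S ∆ A i)) ≤ η := by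
    rwa [(hT.iterate (n k)).measureReal_preimage (hS.symmDiff (hAm i)).nullMeasurableSet]
  have h2 : μ.real {x | P k (T^[n k] x) ≠ P k x} ≤ η := (hnP k).2.trans hk.le
  have hsub : (T^[n k] ⁻¹' S) ∆ S ⊆
      (T^[n k] ⁻¹' (S ∆ A i) ∪ {x | P k (T^[n k] x) ≠ P k x}) ∪ S ∆ A i := by
    intro x hx
    by_contra hcon
    simp only [mem_union, not_or, mem_ofPred_eq, not_not] at hcon
    obtain ⟨⟨ha, hb⟩, hc⟩ := hcon
    have hb' := congrFun (finFunctionFinEquiv.injective hb) ⟨i, hik⟩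
    have hb'' : T^[n k] x ∈ A i ↔ x ∈ A i := by
      simp only [Q] at hb'
      by_cases u : T^[n k] x ∈ A i <;> by_cases v : x ∈ A i <;> simp_all
    simp only [mem_symmDiff, mem_preimage] at hx ha hc
    tauto
  have h3 := (measureReal_mono (μ := μ) hsub).trans ((measureReal_union_le _ _).trans
      (add_le_add_left (measureReal_union_le _ _) _))
  refine le_trans ?_ hηε
  rw [← ofReal_measureReal]
  exact ENNReal.ofReal_le_ofReal (by linarith)

/-- Theorem `RigidtyCondition`.
For an invertible ergodic `ℤ`-system `(X, μ, T)`, the following are equivalent: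
(1) `X` is rigid; (2) for every rate function `U` there is a Følner sequence `(F_n)` for
`ℕ` with `h_slow^{U,(F_n)}(X) = 0`; (3) for `L(n) = log n` there is a Følner sequence
`(F_n)` for `ℕ` with `h_slow^{L,(F_n)}(X) = 0`. -/
theorem rigid_iff_zero_slow_entropy
    {X : Type*} [MeasurableSpace X] [StandardBorelSpace X]
    (μ : Measure X) [IsProbabilityMeasure μ]
    (T : X ≃ᵐ X) (hT : MeasurePreserving T μ μ) (hErg : Ergodic (⇑T) μ) :
    (IsRigidSystem (⇑T) μ ↔
      ∀ U : ℕ → ℝ, IsRateFunction U →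
        ∃ F : ℕ → Finset ℕ, IsFolnerNat F ∧ slowEntropyNat (⇑T) μ U F = 0) ∧
    (IsRigidSystem (⇑T) μ ↔
      ∃ F : ℕ → Finset ℕ, IsFolnerNat F ∧
        slowEntropyNat (⇑T) μ (fun n => Real.log n) F = 0) := by
  have hlogm : Monotone fun n : ℕ => Real.log n := by
    intro a b hab
    simp only
    rcases Nat.eq_zero_or_pos a with h | h
    · subst h
      simpa using Real.log_natCast_nonneg b
    · exact Real.log_le_log (by exact_mod_cast h) (by exact_mod_cast hab)
  have hlogt : Tendsto (fun n : ℕ => Real.log n) atTop atTop :=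
    Real.tendsto_log_atTop.comp tendsto_natCast_atTop_atTop
  refine ⟨⟨fun h U hU => rigid_forward μ T hT h U hU.2.1 hU.2.2, fun h => ?_⟩,
    ⟨fun h => rigid_forward μ T hT h _ hlogm hlogt, ?_⟩⟩
  · have hpos : ∀ n : ℕ, 0 < Real.log ((n : ℝ) + 3) := fun n =>
      Real.log_pos (by linarith [Nat.cast_nonneg (α := ℝ) n])
    obtain ⟨F, hF, h0⟩ := h (fun n => Real.log ((n : ℝ) + 3)) ⟨hpos, by
      intro a b hab
      have : (a : ℝ) ≤ b := by exact_mod_cast hab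
      exact Real.log_le_log (by positivity) (by linarith), by
      exact Real.tendsto_log_atTop.comp
        (tendsto_atTop_add_const_right _ _ tendsto_natCast_atTop_atTop)⟩
    exact rigid_backward μ T hT _ (Eventually.of_forall hpos) (fun n => le_rfl) F hF h0
  · rintro ⟨F, hF, h0⟩
    refine rigid_backward μ T hT _ (hlogt.eventually_gt_atTop 0) (fun n => ?_) F hF h0
    rcases Nat.eq_zero_or_pos n with h | h
    · subst h
      simpa using Real.log_nonneg (by norm_num : (1 : ℝ) ≤ 3)
    · exact Real.log_le_log (by exact_mod_cast h) (by linarith)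
end

section
/- Let X = (X, μ, T) be an invertible ergodic measure-preserving ℤ-system on a standard Borel probability space. Then X is mildly mixing (i.e. X has no nontrivial rigid factors) if and only if for every finite measurable partition P of X having at least two cells of positive μ-measure and every Følner sequence (F_n) for ℕ, h_slow^{L,(F_n)}(X, P) > 0, where L(n) = log n. -/
open MeasureTheory Filter Set Topology
open scoped ENNReal Classical symmDiff

/-- A mildly mixing system: every (rigid) factor of `X` is trivial (one point mod null
sets), i.e. `X` has no nontrivial rigid factors. -/
def IsMildMixing {X : Type*} [MeasurableSpace X] (T : X → X) (μ : Measure X) : Prop :=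
  ∀ (Z : Type) (mZ : MeasurableSpace Z) (lam : Measure Z) (R : Z → Z) (ρ : X → Z),
    Measurable R → MeasurePreserving R lam lam → Measurable ρ → μ.map ρ = lam →
    (∀ x, ρ (T x) = R (ρ x)) → IsRigidSystem R lam →
    ∀ s : Set Z, MeasurableSet s → lam s = 0 ∨ lam s = 1

section Helpers

variable {X : Type*} [MeasurableSpace X]

lemma aux_lint_card {ι : Type*} (μ : Measure X) (S : Finset ι) (B : ι → Set X)
    [∀ x, DecidablePred fun s => x ∈ B s] (hB : ∀ s, MeasurableSet (B s)) :
    ∫⁻ x, ((S.filter fun s => x ∈ B s).card : ℝ≥0∞) ∂μ = ∑ s ∈ S, μ (B s) := by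
  have h : ∀ x, ((S.filter fun s => x ∈ B s).card : ℝ≥0∞)
      = ∑ s ∈ S, (B s).indicator (fun _ => (1 : ℝ≥0∞)) x := by
    intro x
    rw [Finset.card_filter]
    push_cast
    refine Finset.sum_congr rfl fun s _ => ?_
    by_cases hx : x ∈ B s <;> simp [hx]
  simp_rw [h]
  rw [lintegral_finsetSum]
  · refine Finset.sum_congr rfl fun s _ => ?_
    rw [lintegral_indicator (hB s)]
    simp
  · intro s _
    exact measurable_const.indicator (hB s)

lemma aux_meas_card {ι : Type*} (S : Finset ι) (B : ι → Set X)
    [∀ x, DecidablePred fun s => x ∈ B s] (hB : ∀ s, MeasurableSet (B s)) :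
    Measurable fun x => ((S.filter fun s => x ∈ B s).card : ℝ≥0∞) := by
  have h : (fun x => ((S.filter fun s => x ∈ B s).card : ℝ≥0∞))
      = fun x => ∑ s ∈ S, (B s).indicator (fun _ => (1 : ℝ≥0∞)) x := by
    funext x
    rw [Finset.card_filter]
    push_cast
    refine Finset.sum_congr rfl fun s _ => ?_
    by_cases hx : x ∈ B s <;> simp [hx]
  rw [h]
  exact Finset.measurable_sum _ fun s _ => measurable_const.indicator (hB s)

lemma aux_cov_mem {ι : Type*} [Fintype ι] (T : X → X) (μ : Measure X) {r : ℕ} (P : X → Fin r)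
    (F : Finset ℕ) (ε : ℝ) (E : ι → Set X) (h1 : ∀ i, diamLENat T P F (E i) ε)
    (h2 : ENNReal.ofReal (1 - ε) ≤ μ (⋃ i, E i)) :
    Fintype.card ι ∈ {M : ℕ | ∃ E : Fin M → Set X, (∀ i, diamLENat T P F (E i) ε) ∧
      ENNReal.ofReal (1 - ε) ≤ μ (⋃ i, E i)} := by
  refine ⟨fun i => E ((Fintype.equivFin ι).symm i), fun i => h1 _, ?_⟩
  rw [(Fintype.equivFin ι).symm.surjective.iUnion_comp]
  exact h2

lemma aux_cov_upper (μ : Measure X) [IsProbabilityMeasure μ] (T : X → X)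
    (hT : MeasurePreserving T μ μ) {r : ℕ} (P : X → Fin r) (hP : Measurable P)
    (L : ℕ) (J : ℕ) (φ : ℕ × ℕ → ℕ)
    (hφ : Set.InjOn φ ((Finset.range L ×ˢ Finset.range J : Finset (ℕ × ℕ)) : Set (ℕ × ℕ)))
    (hL : 0 < L) (hJ : 0 < J)
    (ε : ℝ) (hε : 0 < ε)
    (h : ∀ s ∈ Finset.range L ×ˢ Finset.range J,
      μ {x | P (T^[φ s] x) ≠ P (T^[s.1] x)} ≤ ENNReal.ofReal (ε / 2 * ε)) :
    hamCovNat T μ P ((Finset.range L ×ˢ Finset.range J).image φ) ε ≤ r ^ L := by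
  set S := Finset.range L ×ˢ Finset.range J with hS
  have hcS : S.card = L * J := by simp [hS]
  have hcF : (S.image φ).card = S.card := Finset.card_image_of_injOn hφ
  have hSpos : (0 : ℝ) < S.card := by rw [hcS]; positivity
  let B : ℕ × ℕ → Set X := fun s => {x | P (T^[φ s] x) ≠ P (T^[s.1] x)}
  have hmeas : ∀ k, Measurable fun x => P (T^[k] x) := fun k => hP.comp (hT.measurable.iterate k)
  have hB : ∀ s, MeasurableSet (B s) := fun s =>
    (measurableSet_eq_fun (hmeas _) (hmeas _)).compl
  let E : (Fin L → Fin r) → Set X := fun w =>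
    {x | (∀ i : Fin L, P (T^[(i : ℕ)] x) = w i) ∧
      ((S.filter fun s => x ∈ B s).card : ℝ) ≤ ε / 2 * S.card}
  have key := aux_cov_mem T μ P (S.image φ) ε E ?_ ?_
  · have := Nat.sInf_le key
    simpa [hamCovNat] using this
  · rintro w x ⟨hx1, hx2⟩ y ⟨hy1, hy2⟩
    unfold hamDistNat
    rw [hcF, div_le_iff₀ hSpos]
    have hsub : ((S.image φ).filter fun f => P (T^[f] x) ≠ P (T^[f] y)) ⊆
        ((S.filter fun s => x ∈ B s) ∪ (S.filter fun s => y ∈ B s)).image φ := by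
      intro f hf
      simp only [Finset.mem_filter, Finset.mem_image] at hf
      obtain ⟨⟨s, hs, rfl⟩, hne⟩ := hf
      refine Finset.mem_image.2 ⟨s, ?_, rfl⟩
      simp only [Finset.mem_union, Finset.mem_filter, hs, true_and, B, Set.mem_ofPred_eq]
      by_contra hcon
      push Not at hcon
      have hs1 : s.1 < L := by
        rw [hS, Finset.mem_product] at hs
        exact Finset.mem_range.1 hs.1
      apply hne
      rw [hcon.1, hcon.2, hx1 ⟨s.1, hs1⟩, hy1 ⟨s.1, hs1⟩]
    have hc := (Finset.card_le_card hsub).trans (Finset.card_image_le.trans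
      (Finset.card_union_le _ _))
    have hc' : (((S.image φ).filter fun f => P (T^[f] x) ≠ P (T^[f] y)).card : ℝ) ≤
      (S.filter fun s => x ∈ B s).card + (S.filter fun s => y ∈ B s).card := by
      exact_mod_cast hc
    linarith
  · have hU : (⋃ w, E w) = {x | ENNReal.ofReal (ε / 2 * S.card) <
        ((S.filter fun s => x ∈ B s).card : ℝ≥0∞)}ᶜ := by
      ext x
      simp only [Set.mem_iUnion, Set.mem_compl_iff, Set.mem_ofPred_eq, not_lt, E]
      rw [← ENNReal.ofReal_natCast, ENNReal.ofReal_le_ofReal_iff (by positivity)]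
      constructor
      · rintro ⟨w, _, h⟩; exact h
      · intro h; exact ⟨fun i => P (T^[(i : ℕ)] x), fun _ => rfl, h⟩
    rw [hU, prob_compl_eq_one_sub (measurableSet_lt measurable_const (aux_meas_card S B hB)),
      ENNReal.ofReal_sub _ hε.le, ENNReal.ofReal_one]
    refine tsub_le_tsub_left ?_ _
    have hmk := mul_meas_ge_le_lintegral (μ := μ) (aux_meas_card S B hB)
      (ENNReal.ofReal (ε / 2 * S.card))
    rw [aux_lint_card μ S B hB] at hmk
    have hsum : ∑ s ∈ S, μ (B s) ≤ S.card * ENNReal.ofReal (ε / 2 * ε) := by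
      have := Finset.sum_le_card_nsmul S (fun s => μ (B s)) _ h
      simpa using this
    have hmk2 := hmk.trans hsum
    have heq : (S.card : ℝ≥0∞) * ENNReal.ofReal (ε / 2 * ε) =
        ENNReal.ofReal (ε / 2 * S.card) * ENNReal.ofReal ε := by
      rw [← ENNReal.ofReal_natCast, ← ENNReal.ofReal_mul (by positivity),
        ← ENNReal.ofReal_mul (by positivity)]
      congr 1; ring
    rw [heq, ENNReal.mul_le_mul_iff_right (by simp; positivity) (by simp)] at hmk2
    refine le_trans (measure_mono ?_) hmk2
    intro x hx
    rw [Set.mem_ofPred_eq] at hx ⊢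
    exact hx.le

lemma aux_dirB (μ : Measure X) [IsProbabilityMeasure μ] (T : X → X)
    (hT : MeasurePreserving T μ μ) {r : ℕ} (hr : 0 < r) (P : X → Fin r) (hP : Measurable P)
    (n : ℕ → ℕ) (hn : StrictMono n)
    (h : Tendsto (fun k => μ {x | P (T^[n k] x) ≠ P x}) atTop (nhds 0)) :
    ∃ F : ℕ → Finset ℕ, IsFolnerNat F ∧
      slowEntropyPartNat T μ P (fun n => Real.log n) F = 0 := by
  have hk : ∀ m : ℕ, ∃ k0 : ℕ, ∀ k ≥ k0,
      μ {x | P (T^[n k] x) ≠ P x} ≤ ENNReal.ofReal (1 / ((m : ℝ) + 1)) := by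
    intro m
    have := h.eventually (ge_mem_nhds
      (show 0 < ENNReal.ofReal (1 / ((m : ℝ) + 1)) from ENNReal.ofReal_pos.2 (by positivity)))
    exact eventually_atTop.1 this
  choose k0 hk0 using hk
  let J : ℕ → ℕ := fun m => ⌈Real.exp ((m + 1 : ℝ) * r ^ (m + 1))⌉₊
  have hJ : ∀ m, 0 < J m := fun m => Nat.ceil_pos.2 (Real.exp_pos _)
  let φ : ℕ → ℕ × ℕ → ℕ := fun m s => n (k0 m + (m + 1) * s.2) + s.1
  let S : ℕ → Finset (ℕ × ℕ) := fun m => Finset.range (m + 1) ×ˢ Finset.range (J m)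
  have hgap : ∀ a b, n a + b ≤ n (a + b) := by
    intro a b
    induction b with
    | zero => simp
    | succ b ih => have := hn (show a + b < a + (b + 1) by omega); omega
  have hlt : ∀ m (s t : ℕ × ℕ), s.1 < m + 1 → s.2 < t.2 → φ m s < φ m t := by
    intro m s t hs hst
    have h1 := hgap (k0 m + (m + 1) * s.2) (m + 1)
    have h2 : n (k0 m + (m + 1) * s.2 + (m + 1)) ≤ n (k0 m + (m + 1) * t.2) := by
      apply hn.monotone
      have : (m + 1) * (s.2 + 1) ≤ (m + 1) * t.2 := Nat.mul_le_mul_left _ hst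
      rw [mul_add] at this
      omega
    simp only [φ]
    omega
  have hinj : ∀ m, Set.InjOn (φ m) (S m : Set (ℕ × ℕ)) := by
    intro m s hs t ht hst
    simp only [S, Finset.coe_product, Finset.coe_range, Set.mem_prod, Set.mem_Iio] at hs ht
    rcases lt_trichotomy s.2 t.2 with hc | hc | hc
    · exact absurd hst (hlt m s t hs.1 hc).ne
    · refine Prod.ext ?_ hc
      simp only [φ, hc] at hst
      omega
    · exact absurd hst (hlt m t s ht.1 hc).ne'
  have hcard : ∀ m, ((S m).image (φ m)).card = (m + 1) * J m := by
    intro m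
    rw [Finset.card_image_of_injOn (hinj m)]
    simp [S]
  have hinv : Tendsto (fun m : ℕ => 1 / ((m : ℝ) + 1)) atTop (nhds 0) :=
    tendsto_one_div_add_atTop_nhds_zero_nat
  refine ⟨fun m => (S m).image (φ m), ⟨?_, ?_⟩, ?_⟩
  · intro m
    rw [← Finset.card_pos, hcard]
    have := hJ m
    positivity
  · intro g
    have hlow : Tendsto (fun m : ℕ => 1 - g * (1 / ((m : ℝ) + 1))) atTop (nhds 1) := by
      simpa using (hinv.const_mul (g : ℝ)).const_sub 1
    refine tendsto_of_tendsto_of_tendsto_of_le_of_le hlow tendsto_const_nhds ?_ ?_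
    · intro m
      have hsub : (Finset.range (m + 1 - g) ×ˢ Finset.range (J m)).image
          (fun s => φ m (s.1 + g, s.2)) ⊆
          ((S m).image (φ m)).image (fun h => g + h) ∩ (S m).image (φ m) := by
        intro f hf
        simp only [Finset.mem_image, Finset.mem_product, Finset.mem_range] at hf
        obtain ⟨s, ⟨hs1, hs2⟩, rfl⟩ := hf
        refine Finset.mem_inter.2 ⟨?_, ?_⟩
        · refine Finset.mem_image.2 ⟨φ m s, Finset.mem_image_of_mem _ ?_, ?_⟩
          · simp only [S, Finset.mem_product, Finset.mem_range]
            omega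
          · simp only [φ]; omega
        · refine Finset.mem_image_of_mem _ ?_
          simp only [S, Finset.mem_product, Finset.mem_range]
          omega
      have hc := Finset.card_le_card hsub
      rw [Finset.card_image_of_injOn] at hc
      · simp only [Finset.card_product, Finset.card_range] at hc
        have hc' : ((m + 1 - g : ℕ) : ℝ) * J m ≤
          ((((S m).image (φ m)).image (fun h => g + h) ∩ (S m).image (φ m)).card : ℝ) := by
          exact_mod_cast hc
        have hsubr : (m : ℝ) + 1 - g ≤ ((m + 1 - g : ℕ) : ℝ) := by
          have : m + 1 ≤ (m + 1 - g) + g := by omega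
          have : ((m + 1 : ℕ) : ℝ) ≤ ((m + 1 - g : ℕ) : ℝ) + g := by exact_mod_cast this
          push_cast at this
          linarith
        have hJ' : (0 : ℝ) < J m := by exact_mod_cast hJ m
        beta_reduce
        rw [hcard, le_div_iff₀ (by push_cast; positivity)]
        refine le_trans ?_ hc'
        refine le_trans (le_of_eq ?_) (mul_le_mul_of_nonneg_right hsubr hJ'.le)
        push_cast
        field_simp
      · intro s hs t ht hst
        simp only [Finset.coe_product, Finset.coe_range, Set.mem_prod, Set.mem_Iio] at hs ht
        have := hinj m (x₁ := (s.1 + g, s.2)) (x₂ := (t.1 + g, t.2))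
          (by simp [S]; omega) (by simp [S]; omega) hst
        simp only [Prod.mk.injEq] at this
        exact Prod.ext (by omega) this.2
    · intro m
      apply div_le_one_of_le₀ _ (by positivity)
      exact Nat.cast_le.2 (Finset.card_le_card Finset.inter_subset_right)
  · unfold slowEntropyPartNat
    simp only [ENNReal.iSup_eq_zero]
    intro ε hε
    have hε : 0 < ε := hε
    apply Tendsto.limsup_eq
    have hup : Tendsto (fun m : ℕ => ENNReal.ofReal (1 / ((m : ℝ) + 1))) atTop (nhds 0) := by
      simpa using ENNReal.tendsto_ofReal hinv
    refine tendsto_of_tendsto_of_tendsto_of_le_of_le' tendsto_const_nhds hup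
      (Eventually.of_forall fun _ => zero_le) ?_
    have hev : ∀ᶠ m : ℕ in atTop, 1 / ((m : ℝ) + 1) ≤ ε / 2 * ε :=
      hinv.eventually (ge_mem_nhds (by positivity))
    filter_upwards [hev] with m hm
    apply ENNReal.ofReal_le_ofReal
    have hcov : hamCovNat T μ P ((S m).image (φ m)) ε ≤ r ^ (m + 1) := by
      refine aux_cov_upper μ T hT P hP (m + 1) (J m) (φ m) (hinj m) (by omega) (hJ m) ε hε ?_
      intro s hs
      refine le_trans ?_ ((hk0 m (k0 m + (m + 1) * s.2) (by omega)).trans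
        (ENNReal.ofReal_le_ofReal hm))
      have hms : MeasurableSet {x | P (T^[n (k0 m + (m + 1) * s.2)] x) ≠ P x} :=
        (measurableSet_eq_fun (hP.comp (hT.measurable.iterate _)) hP).compl
      rw [← (hT.iterate s.1).measure_preimage hms.nullMeasurableSet]
      apply le_of_eq
      congr 1
      ext x
      simp only [Set.mem_ofPred_eq, Set.mem_preimage, φ, Function.iterate_add_apply]
    have hcov' : (hamCovNat T μ P ((S m).image (φ m)) ε : ℝ) ≤ (r : ℝ) ^ (m + 1) := by
      exact_mod_cast hcov
    have hr' : (0 : ℝ) < r := by exact_mod_cast hr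
    have hlog : ((m : ℝ) + 1) * r ^ (m + 1) ≤ Real.log (((S m).image (φ m)).card : ℕ) := by
      rw [hcard, Real.le_log_iff_exp_le (by have := hJ m; positivity)]
      refine (Nat.le_ceil _).trans ?_
      exact Nat.cast_le.2 (Nat.le_mul_of_pos_left (J m) (Nat.succ_pos m))
    have hpos : 0 < ((m : ℝ) + 1) * r ^ (m + 1) := by positivity
    rw [div_le_div_iff₀ (hpos.trans_le hlog) (by positivity)]
    calc (hamCovNat T μ P ((S m).image (φ m)) ε : ℝ) * ((m : ℝ) + 1)
        ≤ r ^ (m + 1) * ((m : ℝ) + 1) := by gcongr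
      _ ≤ _ := by linarith

lemma aux_good_pair (μ : Measure X) [IsProbabilityMeasure μ] (T : X → X)
    (hT : MeasurePreserving T μ μ) {r : ℕ} (P : X → Fin r) (hP : Measurable P)
    (F : Finset ℕ) (ε : ℝ) (hε : 0 < ε) (hε1 : ε < 1) (K : ℕ)
    (h : 2 * (r ^ (hamCovNat T μ P F ε) * K) < F.card) :
    ∃ t ≥ K, μ {x | P (T^[t] x) ≠ P x} ≤ ENNReal.ofReal (8 * ε) := by
  have hmeas : ∀ k, Measurable fun x => P (T^[k] x) := fun k => hP.comp (hT.measurable.iterate k)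
  let W : X → (F → Fin r) := fun x f => P (T^[(f : ℕ)] x)
  have hW : Measurable W := measurable_pi_lambda _ fun f => hmeas _
  have hNpos : 0 < F.card := by omega
  have hNpos' : (0 : ℝ) < F.card := by exact_mod_cast hNpos
  have hWd : ∀ x y z, W x = W y → hamDistNat T P F x z = hamDistNat T P F y z := by
    intro x y z hxy
    unfold hamDistNat
    congr 3
    refine Finset.filter_congr fun f hf => ?_
    have : P (T^[f] x) = P (T^[f] y) := congrFun hxy ⟨f, hf⟩
    rw [this]
  have hmem := Nat.sInf_mem ⟨_, aux_cov_mem T μ P F ε (fun w : F → Fin r => {x | W x = w})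
    (by
      intro w x hx y hy
      have hxy : W x = W y := hx.trans hy.symm
      rw [hWd x y y hxy]
      simp [hamDistNat, hε.le])
    (by
      have : (⋃ w : F → Fin r, {x | W x = w}) = Set.univ := by ext; simp
      rw [this, measure_univ, ENNReal.ofReal_le_one]
      linarith)⟩
  change hamCovNat T μ P F ε ∈ _ at hmem
  generalize hamCovNat T μ P F ε = M at h hmem
  obtain ⟨E, hE1, hE2⟩ := hmem
  have hUne : (⋃ i, E i).Nonempty := by
    by_contra hcon
    rw [Set.not_nonempty_iff_eq_empty] at hcon
    rw [hcon, measure_empty] at hE2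
    have := ENNReal.ofReal_pos.2 (show 0 < 1 - ε by linarith)
    exact absurd hE2 (not_le.2 this)
  obtain ⟨x0, hx0⟩ := hUne
  obtain ⟨i0, -⟩ := Set.mem_iUnion.1 hx0
  have hc : ∀ i, ∃ c : X, (E i).Nonempty → c ∈ E i := by
    intro i
    by_cases hi : (E i).Nonempty
    · exact ⟨hi.some, fun _ => hi.some_mem⟩
    · exact ⟨x0, fun h => absurd h hi⟩
  choose c hc using hc
  have hι : ∀ w : F → Fin r, ∃ i, w ∈ W '' (⋃ i, E i) → ∃ y ∈ E i, W y = w := by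
    intro w
    by_cases hw : w ∈ W '' (⋃ i, E i)
    · obtain ⟨y, hy, hyw⟩ := hw
      obtain ⟨i, hi⟩ := Set.mem_iUnion.1 hy
      exact ⟨i, fun _ => ⟨y, hi, hyw⟩⟩
    · exact ⟨i0, fun h => absurd h hw⟩
  choose ι hι using hι
  let B : ℕ → Set X := fun f => {x | P (T^[f] x) ≠ P (T^[f] (c (ι (W x))))}
  have hB : ∀ f, MeasurableSet (B f) := fun f => by
    refine (measurableSet_eq_fun (hmeas _) ?_).compl
    exact (measurable_of_finite (fun w : F → Fin r => P (T^[f] (c (ι w))))).comp hW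
  let U' : Set X := W ⁻¹' (W '' (⋃ i, E i))
  have hU'm : MeasurableSet U' := hW (Set.toFinite _).measurableSet
  have hU'c : μ U'ᶜ ≤ ENNReal.ofReal ε := by
    rw [prob_compl_eq_one_sub hU'm, tsub_le_iff_right]
    have h1 : ENNReal.ofReal (1 - ε) ≤ μ U' :=
      hE2.trans (measure_mono (Set.subset_preimage_image _ _))
    calc (1 : ℝ≥0∞) = ENNReal.ofReal ε + ENNReal.ofReal (1 - ε) := by
          rw [← ENNReal.ofReal_add hε.le (by linarith)]; simp
      _ ≤ _ := by gcongr
  have hsum : ∑ f ∈ F, μ (B f) ≤ F.card * ENNReal.ofReal (2 * ε) := by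
    rw [← aux_lint_card μ F B hB]
    have hpt : ∀ x, ((F.filter fun f => x ∈ B f).card : ℝ≥0∞) ≤
        ENNReal.ofReal ε * F.card + U'ᶜ.indicator (fun _ => (F.card : ℝ≥0∞)) x := by
      intro x
      by_cases hx : x ∈ U'
      · refine le_add_right ?_
        obtain ⟨y, hy, hyx⟩ := hι (W x) hx
        have hd := hE1 _ y hy _ (hc _ ⟨y, hy⟩)
        rw [hWd y x _ hyx] at hd
        unfold hamDistNat at hd
        rw [div_le_iff₀ hNpos'] at hd
        rw [← ENNReal.ofReal_natCast, ← ENNReal.ofReal_natCast, ← ENNReal.ofReal_mul hε.le]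
        exact ENNReal.ofReal_le_ofReal hd
      · refine le_add_left ?_
        have hx' : x ∈ U'ᶜ := hx
        rw [Set.indicator_of_mem hx']
        exact_mod_cast Finset.card_filter_le _ _
    refine (lintegral_mono hpt).trans ?_
    rw [lintegral_add_left measurable_const, lintegral_indicator hU'm.compl]
    simp only [lintegral_const, measure_univ, mul_one, Measure.restrict_apply MeasurableSet.univ,
      Set.univ_inter]
    rw [two_mul, ENNReal.ofReal_add hε.le hε.le, mul_add, mul_comm (ENNReal.ofReal ε)]
    gcongr
  let G := F.filter fun f => μ (B f) ≤ ENNReal.ofReal (4 * ε)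
  let Bd := F.filter fun f => ¬ μ (B f) ≤ ENNReal.ofReal (4 * ε)
  have hGB : G.card + Bd.card = F.card := Finset.card_filter_add_card_filter_not _
  have hBd : 2 * Bd.card ≤ F.card := by
    have h1 : (Bd.card : ℝ≥0∞) * ENNReal.ofReal (4 * ε) ≤ ∑ f ∈ Bd, μ (B f) := by
      have := Finset.card_nsmul_le_sum Bd (fun f => μ (B f)) (ENNReal.ofReal (4 * ε))
        (fun f hf => (not_le.1 (Finset.mem_filter.1 hf).2).le)
      simpa using this
    have h2 : ∑ f ∈ Bd, μ (B f) ≤ ∑ f ∈ F, μ (B f) :=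
      Finset.sum_le_sum_of_subset (Finset.filter_subset _ _)
    have h3 := (h1.trans h2).trans hsum
    rw [← ENNReal.ofReal_natCast, ← ENNReal.ofReal_natCast, ← ENNReal.ofReal_mul (by positivity),
      ← ENNReal.ofReal_mul (by positivity), ENNReal.ofReal_le_ofReal_iff (by positivity)] at h3
    have h4 : (2 * Bd.card : ℝ) ≤ F.card := by nlinarith
    exact_mod_cast h4
  obtain ⟨col, -, hcol⟩ := Finset.exists_lt_card_fiber_of_mul_lt_card_of_maps_to
    (s := G) (t := (Finset.univ : Finset (Fin M → Fin r)))
    (f := fun f i => P (T^[f] (c i))) (n := K) (fun _ _ => Finset.mem_univ _)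
    (by simp; omega)
  set C := G.filter fun f => (fun i => P (T^[f] (c i))) = col with hC
  have hCne : C.Nonempty := Finset.card_pos.1 (by omega)
  have hmm : C.min' hCne + K ≤ C.max' hCne := by
    have hsub : C ⊆ Finset.Icc (C.min' hCne) (C.max' hCne) := fun f hf =>
      Finset.mem_Icc.2 ⟨C.min'_le f hf, C.le_max' f hf⟩
    have := Finset.card_le_card hsub
    rw [Nat.card_Icc] at this
    omega
  obtain ⟨t, ht⟩ := Nat.exists_eq_add_of_le hmm
  have ha := C.min'_mem hCne
  have hb := C.max'_mem hCne
  generalize C.min' hCne = a at *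
  generalize C.max' hCne = b at *
  simp only [hC, G, Finset.mem_filter] at ha hb
  refine ⟨K + t, by omega, ?_⟩
  have hms : MeasurableSet {x | P (T^[K + t] x) ≠ P x} :=
    (measurableSet_eq_fun (hmeas _) hP).compl
  rw [← (hT.iterate a).measure_preimage hms.nullMeasurableSet]
  have hsub : T^[a] ⁻¹' {x | P (T^[K + t] x) ≠ P x} ⊆ B a ∪ B b := by
    intro x hx
    simp only [Set.mem_preimage, Set.mem_ofPred_eq, ← Function.iterate_add_apply] at hx
    rw [show K + t + a = b by omega] at hx
    simp only [Set.mem_union, B, Set.mem_ofPred_eq]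
    by_contra hcon
    push Not at hcon
    apply hx
    rw [hcon.1, hcon.2]
    have := congrFun (ha.2.trans hb.2.symm) (ι (W x))
    exact this.symm
  refine (measure_mono hsub).trans ((measure_union_le _ _).trans ?_)
  refine (add_le_add ha.1.2 hb.1.2).trans ?_
  rw [← ENNReal.ofReal_add (by positivity) (by positivity)]
  apply ENNReal.ofReal_le_ofReal
  linarith

lemma aux_folner_card (F : ℕ → Finset ℕ) (hF : IsFolnerNat F) :
    Tendsto (fun n => (F n).card) atTop atTop := by
  have h1 := hF.2 1
  rw [tendsto_atTop]
  intro b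
  have hlt : (1 : ℝ) - 1 / ((b : ℝ) + 1) < 1 := by
    have : (0 : ℝ) < 1 / ((b : ℝ) + 1) := by positivity
    linarith
  filter_upwards [h1.eventually (lt_mem_nhds hlt)] with n hn
  have hne := hF.1 n
  have hpos : 0 < (F n).card := Finset.card_pos.2 hne
  have hpos' : (0 : ℝ) < (F n).card := by exact_mod_cast hpos
  have hc : (((F n).image fun h => 1 + h) ∩ F n).card < (F n).card := by
    apply Finset.card_lt_card
    refine ⟨Finset.inter_subset_right, fun hcon => ?_⟩
    have := hcon ((F n).min'_mem hne)
    obtain ⟨y, hy, hy2⟩ := Finset.mem_image.1 (Finset.mem_inter.1 this).1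
    have := (F n).min'_le y hy
    omega
  have hc' : ((((F n).image fun h => 1 + h) ∩ F n).card : ℝ) + 1 ≤ (F n).card := by
    exact_mod_cast hc
  rw [lt_div_iff₀ hpos'] at hn
  have h3 : (1 : ℝ) < 1 / ((b : ℝ) + 1) * (F n).card + 0 := by
    by_contra hcon
    have h4 : 1 / ((b : ℝ) + 1) * (F n).card ≤ 1 := by linarith
    nlinarith
  have h5 : ((b : ℝ) + 1) < (F n).card := by
    rw [add_zero, one_div, inv_mul_eq_div, lt_div_iff₀ (by positivity)] at h3
    linarith
  have h6 : b + 1 < (F n).card := by exact_mod_cast h5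
  omega

lemma aux_dirA (μ : Measure X) [IsProbabilityMeasure μ] (T : X → X)
    (hT : MeasurePreserving T μ μ) {r : ℕ} (hr : 2 ≤ r) (P : X → Fin r) (hP : Measurable P)
    (F : ℕ → Finset ℕ) (hF : IsFolnerNat F)
    (h : slowEntropyPartNat T μ P (fun n => Real.log n) F = 0)
    (ε : ℝ) (hε : 0 < ε) (hε1 : ε < 1) (K : ℕ) :
    ∃ t ≥ K, μ {x | P (T^[t] x) ≠ P x} ≤ ENNReal.ofReal (8 * ε) := by
  unfold slowEntropyPartNat at h
  simp only [ENNReal.iSup_eq_zero] at h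
  have h0 := h ε hε
  have hlr : 0 < Real.log r := Real.log_pos (by exact_mod_cast hr)
  have hδ : (0 : ℝ) < 1 / (2 * Real.log r) := by positivity
  have hev := eventually_lt_of_limsup_lt (f := atTop)
    (b := ENNReal.ofReal (1 / (2 * Real.log r)))
    (by rw [h0]; exact ENNReal.ofReal_pos.2 hδ)
  have hcard := (aux_folner_card F hF).eventually_gt_atTop (4 * K ^ 2 + 1)
  obtain ⟨m, hm1, hm2⟩ := (hev.and hcard).exists
  refine aux_good_pair μ T hT P hP (F m) ε hε hε1 K ?_
  generalize hamCovNat T μ P (F m) ε = M at hm1 ⊢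
  generalize (F m).card = N at hm1 hm2 ⊢
  have hN : (1 : ℝ) < N := by exact_mod_cast (show 1 < N by omega)
  have hlN : 0 < Real.log N := Real.log_pos hN
  rw [ENNReal.ofReal_lt_ofReal_iff hδ, div_lt_div_iff₀ hlN (by positivity)] at hm1
  have hpow : (r : ℝ) ^ M ≤ Real.sqrt N := by
    rw [← Real.log_le_log_iff (by positivity) (by positivity), Real.log_pow,
      Real.log_sqrt (by positivity)]
    linarith
  have hsq : 2 * (K : ℝ) < Real.sqrt N := by
    apply Real.lt_sqrt_of_sq_lt
    have : (4 * K ^ 2 + 1 : ℝ) < N := by exact_mod_cast hm2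
    nlinarith
  have hfin : 2 * ((r : ℝ) ^ M * K) < N := by
    have h1 : Real.sqrt N * Real.sqrt N = N := Real.mul_self_sqrt (by positivity)
    have h2 : 0 < Real.sqrt N := by positivity
    calc 2 * ((r : ℝ) ^ M * K) = (r : ℝ) ^ M * (2 * K) := by ring
      _ ≤ Real.sqrt N * (2 * K) := by gcongr
      _ < Real.sqrt N * Real.sqrt N := by gcongr
      _ = N := h1
  exact_mod_cast hfin

/-- The σ-algebra of sets that are rigid along the sequence `n`. -/
def auxRigidAlg (μ : Measure X) [IsProbabilityMeasure μ] (T : X → X)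
    (hT : MeasurePreserving T μ μ) (n : ℕ → ℕ) : MeasurableSpace X where
  MeasurableSet' A := MeasurableSet A ∧
    Tendsto (fun k => μ ((T^[n k] ⁻¹' A) ∆ A)) atTop (nhds 0)
  measurableSet_empty := by simp
  measurableSet_compl := by
    rintro A ⟨hA, h⟩
    refine ⟨hA.compl, ?_⟩
    simpa only [Set.preimage_compl, compl_symmDiff_compl] using h
  measurableSet_iUnion := by
    intro f hf
    have hm : ∀ i, MeasurableSet (f i) := fun i => (hf i).1
    refine ⟨MeasurableSet.iUnion hm, ?_⟩
    rw [ENNReal.tendsto_nhds_zero]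
    intro ε hε
    have hε3 : 0 < ε / 3 := by simpa using hε.ne'
    let A : Set X := ⋃ i, f i
    let Am : ℕ → Set X := fun m => ⋃ i ∈ Finset.range m, f i
    have hAm : ∀ m, MeasurableSet (Am m) := fun m => Finset.measurableSet_biUnion _ fun i _ => hm i
    have hA : MeasurableSet A := MeasurableSet.iUnion hm
    have htail : Tendsto (fun m => μ (A \ Am m)) atTop (nhds 0) := by
      have := tendsto_measure_iInter_atTop (μ := μ) (s := fun m => A \ Am m)
        (fun m => (hA.diff (hAm m)).nullMeasurableSet)
        (by
          intro a b hab x hx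
          refine ⟨hx.1, fun hxa => hx.2 ?_⟩
          simp only [Am, Set.mem_iUnion, Finset.mem_range] at hxa ⊢
          obtain ⟨i, hi, hxi⟩ := hxa
          exact ⟨i, by omega, hxi⟩)
        ⟨0, measure_ne_top _ _⟩
      have hemp : (⋂ m, A \ Am m) = ∅ := by
        ext x
        simp only [Set.mem_iInter, Set.mem_empty_iff_false, iff_false]
        intro hx
        obtain ⟨i, hi⟩ := Set.mem_iUnion.1 (hx 0).1
        apply (hx (i + 1)).2
        simp only [Am, Set.mem_iUnion, Finset.mem_range]
        exact ⟨i, by omega, hi⟩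
      rwa [hemp, measure_empty] at this
    obtain ⟨m, hmt⟩ := ((ENNReal.tendsto_nhds_zero.1 htail) (ε / 3) hε3).exists
    have hsum : Tendsto (fun k => ∑ i ∈ Finset.range m, μ ((T^[n k] ⁻¹' f i) ∆ f i))
        atTop (nhds 0) := by
      simpa using tendsto_finsetSum (Finset.range m) (fun i _ => (hf i).2)
    filter_upwards [ENNReal.tendsto_nhds_zero.1 hsum (ε / 3) hε3] with k hk
    have hsub : (T^[n k] ⁻¹' A) ∆ A ⊆
        (T^[n k] ⁻¹' (A \ Am m) ∪ (A \ Am m)) ∪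
          ⋃ i ∈ Finset.range m, (T^[n k] ⁻¹' f i) ∆ f i := by
      intro x hx
      rw [Set.mem_symmDiff] at hx
      by_contra hcon
      simp only [Set.mem_union, not_or, Set.mem_preimage, Set.mem_sdiff, not_and, not_not,
        Set.mem_iUnion, not_exists, Finset.mem_range, Set.mem_symmDiff, Am, exists_prop] at hcon
      simp only [not_forall, not_not, exists_prop] at hcon
      obtain ⟨⟨h1, h2⟩, h3⟩ := hcon
      rcases hx with ⟨ha, hb⟩ | ⟨ha, hb⟩
      · obtain ⟨i, hi, hxi⟩ := h1 ha
        exact hb (Set.mem_iUnion.2 ⟨i, (h3 i hi).1 hxi⟩)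
      · obtain ⟨i, hi, hxi⟩ := h2 ha
        exact hb (Set.mem_iUnion.2 ⟨i, (h3 i hi).2 hxi⟩)
    calc μ ((T^[n k] ⁻¹' A) ∆ A)
        ≤ _ := measure_mono hsub
      _ ≤ (μ (T^[n k] ⁻¹' (A \ Am m)) + μ (A \ Am m)) +
          ∑ i ∈ Finset.range m, μ ((T^[n k] ⁻¹' f i) ∆ f i) :=
        (measure_union_le _ _).trans (add_le_add (measure_union_le _ _)
          (measure_biUnion_finset_le _ _))
      _ ≤ (ε / 3 + ε / 3) + ε / 3 := by
        rw [(hT.iterate (n k)).measure_preimage (hA.diff (hAm m)).nullMeasurableSet]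
        gcongr
      _ = ε := ENNReal.add_thirds ε

lemma aux_not_mild (μ : Measure X) [IsProbabilityMeasure μ] (T : X → X)
    (hT : MeasurePreserving T μ μ) {r : ℕ} (P : X → Fin r) (hP : Measurable P)
    (hij : ∃ i j : Fin r, i ≠ j ∧ 0 < μ (P ⁻¹' {i}) ∧ 0 < μ (P ⁻¹' {j}))
    (n : ℕ → ℕ) (hn : StrictMono n) (hn0 : 0 < n 0)
    (h : Tendsto (fun k => μ {x | P (T^[n k] x) ≠ P x}) atTop (nhds 0)) :
    ¬ IsMildMixing T μ := by
  intro hmild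
  let ρ : X → (ℕ → Fin r) := fun x i => P (T^[i] x)
  have hmeas : ∀ k, Measurable fun x => P (T^[k] x) := fun k => hP.comp (hT.measurable.iterate k)
  have hρ : Measurable ρ := measurable_pi_lambda _ fun i => hmeas i
  let R : (ℕ → Fin r) → (ℕ → Fin r) := fun z i => z (i + 1)
  have hR : Measurable R := measurable_pi_lambda _ fun i => measurable_pi_apply _
  have hsemi : Function.Semiconj ρ T R := by
    intro x
    funext i
    simp [ρ, R, Function.iterate_succ_apply]
  have hRm : MeasurePreserving R (μ.map ρ) (μ.map ρ) := by
    refine ⟨hR, ?_⟩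
    rw [Measure.map_map hR hρ, ← hsemi.comp_eq, ← Measure.map_map hρ hT.measurable, hT.map_eq]
  have hρ' : @Measurable _ _ (auxRigidAlg μ T hT n) _ ρ := by
    refine @measurable_pi_lambda _ _ _ (auxRigidAlg μ T hT n) _ _ fun i => ?_
    intro s hs
    refine ⟨hmeas i hs, ?_⟩
    refine tendsto_of_tendsto_of_tendsto_of_le_of_le tendsto_const_nhds h
      (fun _ => zero_le) fun k => ?_
    have hms : MeasurableSet {x | P (T^[n k] x) ≠ P x} :=
      (measurableSet_eq_fun (hmeas _) hP).compl
    dsimp only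
    rw [← (hT.iterate i).measure_preimage hms.nullMeasurableSet]
    apply measure_mono
    intro x hx hcon
    rw [Set.mem_symmDiff] at hx
    simp only [Set.mem_preimage, ρ, ← Function.iterate_add_apply] at hx hcon
    rw [add_comm i (n k), hcon] at hx
    tauto
  have hrig : IsRigidSystem R (μ.map ρ) := by
    refine ⟨n, hn, hn0, fun A hA => ?_⟩
    have h2 := (hρ' hA).2
    refine h2.congr fun k => ?_
    rw [Measure.map_apply hρ (((hR.iterate _) hA).symmDiff hA)]
    congr 1
    ext x
    simp only [Set.mem_symmDiff, Set.mem_preimage, (hsemi.iterate_right (n k)).eq]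
  obtain ⟨i, j, hne, hi, hj⟩ := hij
  have hsm : MeasurableSet {z : ℕ → Fin r | z 0 = i} :=
    measurableSet_eq_fun (measurable_pi_apply 0) measurable_const
  have hpre : ρ ⁻¹' {z : ℕ → Fin r | z 0 = i} = P ⁻¹' {i} := by
    ext x; simp [ρ]
  have := hmild (ℕ → Fin r) inferInstance (μ.map ρ) R ρ hR hRm hρ rfl hsemi.eq hrig _ hsm
  rw [Measure.map_apply hρ hsm, hpre] at this
  rcases this with h0 | h1
  · exact hi.ne' h0
  · have hc : μ (P ⁻¹' {i})ᶜ = 0 := by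
      rw [prob_compl_eq_zero_iff (hP (MeasurableSet.singleton i))]; exact h1
    have : P ⁻¹' {j} ⊆ (P ⁻¹' {i})ᶜ := by
      intro x hx hx'
      simp only [Set.mem_preimage, Set.mem_singleton_iff] at hx hx'
      exact hne (hx'.symm.trans hx)
    exact hj.ne' (measure_mono_null this hc)

end Helpers

/-- Corollary `MildMixingCondition`.
An invertible ergodic `ℤ`-system `(X, μ, T)` is mildly mixing iff for every finite
measurable partition `P` with at least two cells of positive measure and every Følner
sequence `(F_n)` for `ℕ`, `h_slow^{L,(F_n)}(X, P) > 0`, where `L(n) = log n`. -/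
theorem mild_mixing_iff_positive_log_slow_entropy
    {X : Type*} [MeasurableSpace X] [StandardBorelSpace X]
    (μ : Measure X) [IsProbabilityMeasure μ]
    (T : X ≃ᵐ X) (hT : MeasurePreserving T μ μ) (hErg : Ergodic (⇑T) μ) :
    IsMildMixing (⇑T) μ ↔
      ∀ (r : ℕ) (P : X → Fin r), Measurable P →
        (∃ i j : Fin r, i ≠ j ∧ 0 < μ (P ⁻¹' {i}) ∧ 0 < μ (P ⁻¹' {j})) →
        ∀ F : ℕ → Finset ℕ, IsFolnerNat F →
          0 < slowEntropyPartNat (⇑T) μ P (fun n => Real.log n) F := by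
  constructor
  · intro hmild r P hP hij F hF
    by_contra hcon
    have h0 : slowEntropyPartNat (⇑T) μ P (fun n => Real.log n) F = 0 := by
      simpa using hcon
    have hr : 2 ≤ r := by
      obtain ⟨i, j, hne, -⟩ := hij
      have := i.2
      have := j.2
      by_contra hr
      exact hne (Fin.ext (by omega))
    have key := aux_dirA μ T hT hr P hP F hF h0
    obtain ⟨n, hn, hn2⟩ := Filter.extraction_forall_of_frequently
      (P := fun k t => 0 < t ∧
        μ {x | P (T^[t] x) ≠ P x} ≤ ENNReal.ofReal (8 * (1 / ((k : ℝ) + 2))))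
      (by
        intro k
        rw [Filter.frequently_atTop]
        intro a
        obtain ⟨t, ht, hμ⟩ := key (1 / ((k : ℝ) + 2)) (by positivity)
          (by rw [div_lt_one (by positivity)]; have : (0 : ℝ) ≤ k := by positivity
              linarith) (a + 1)
        exact ⟨t, by omega, by omega, hμ⟩)
    refine aux_not_mild μ T hT P hP hij n hn (hn2 0).1 ?_ hmild
    have hlim : Tendsto (fun k : ℕ => ENNReal.ofReal (8 * (1 / ((k : ℝ) + 2)))) atTop
        (nhds 0) := by
      have h1 : Tendsto (fun k : ℕ => 1 / ((k : ℝ) + 2)) atTop (nhds 0) := by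
        have := (tendsto_add_atTop_iff_nat 1).2
          (tendsto_one_div_add_atTop_nhds_zero_nat (𝕜 := ℝ))
        refine this.congr fun k => ?_
        push_cast
        ring
      simpa using ENNReal.tendsto_ofReal (h1.const_mul 8)
    exact tendsto_of_tendsto_of_tendsto_of_le_of_le tendsto_const_nhds hlim
      (fun _ => zero_le) fun k => (hn2 k).2
  · intro hall Z mZ lam R ρ hR hRm hρ hmap hsemi hrig s hs
    by_contra hcon
    push Not at hcon
    obtain ⟨n, hn, hn0, hlim⟩ := hrig
    have hsemi' : Function.Semiconj ρ T R := hsemi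
    have hA : MeasurableSet (ρ ⁻¹' s) := hρ hs
    have hμA : μ (ρ ⁻¹' s) = lam s := by rw [← hmap, Measure.map_apply hρ hs]
    let P : X → Fin 2 := fun x => if x ∈ ρ ⁻¹' s then 0 else 1
    have hP : Measurable P := Measurable.ite hA measurable_const measurable_const
    have hlim' : Tendsto (fun k => μ {x | P (T^[n k] x) ≠ P x}) atTop (nhds 0) := by
      refine (hlim s hs).congr fun k => ?_
      rw [← hmap, Measure.map_apply hρ (((hR.iterate _) hs).symmDiff hs)]
      congr 1
      ext x
      simp only [Set.mem_symmDiff, Set.mem_preimage, Set.mem_ofPred_eq, P,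
        ← (hsemi'.iterate_right (n k)).eq]
      by_cases h1 : ρ (T^[n k] x) ∈ s <;> by_cases h2 : ρ x ∈ s <;> simp [h1, h2]
    obtain ⟨F, hF, h0⟩ := aux_dirB μ T hT (by norm_num) P hP n hn hlim'
    have hp0 : P ⁻¹' {0} = ρ ⁻¹' s := by
      ext x; by_cases h2 : ρ x ∈ s <;> simp [P, h2]
    have hp1 : P ⁻¹' {1} = (ρ ⁻¹' s)ᶜ := by
      ext x; by_cases h2 : ρ x ∈ s <;> simp [P, h2]
    refine (hall 2 P hP ⟨0, 1, by simp, ?_, ?_⟩ F hF).ne' h0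
    · rw [hp0, hμA]; exact pos_iff_ne_zero.2 hcon.1
    · rw [hp1]
      refine pos_iff_ne_zero.2 fun hz => hcon.2 ?_
      rw [← hμA]
      exact (prob_compl_eq_zero_iff hA).1 hz
end
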